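/- arXiv:2305.16258 — 3 statements merged into one kernel-verified Lean document; each statement's English description precedes it below -/
import Mathlib

section
/- Every finite simple (theta, pyramid, prism, wheel)-free graph either has a clique cutset, or is a complete graph, or is a hole. -/
open SimpleGraph

namespace Paper

variable {V : Type*}

/-- `G` contains an induced subgraph isomorphic to `H`. -/
def ContainsInduced {W : Type*} (G : SimpleGraph V) (H : SimpleGraph W) : Prop :=
  ∃ S : Set V, Nonempty (G.induce S ≃g H)

/-- `G` is `H`-free: no induced subgraph of `G` is isomorphic to `H`. -/
def Free {W : Type*} (G : SimpleGraph V) (H : SimpleGraph W) : Prop :=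
  ¬ ContainsInduced G H

/-- The diamond: `K₄` minus an edge. -/
def diamond : SimpleGraph (Fin 4) :=
  (⊤ : SimpleGraph (Fin 4)).deleteEdges {s(0, 1)}

/-- `S` induces a hole (an induced cycle of length at least 4) in `G`. -/
def IsHoleSet (G : SimpleGraph V) (S : Set V) : Prop :=
  ∃ n : ℕ, 4 ≤ n ∧ Nonempty (G.induce S ≃g cycleGraph n)

/-- `G` contains an even hole. -/
def HasEvenHole (G : SimpleGraph V) : Prop :=
  ∃ S : Set V, ∃ n : ℕ, 4 ≤ n ∧ Even n ∧ Nonempty (G.induce S ≃g cycleGraph n)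

/-- The union of the vertex sets of two walks induces a hole in `G`. -/
def PairHole (G : SimpleGraph V) {a b c d : V} (P : G.Walk a b) (Q : G.Walk c d) : Prop :=
  IsHoleSet G {v | v ∈ P.support ∨ v ∈ Q.support}

/-- `G` contains a theta. -/
def HasTheta (G : SimpleGraph V) : Prop :=
  ∃ (a b : V) (P₁ P₂ P₃ : G.Walk a b),
    a ≠ b ∧ ¬ G.Adj a b ∧
    P₁.IsPath ∧ P₂.IsPath ∧ P₃.IsPath ∧
    PairHole G P₁ P₂ ∧ PairHole G P₁ P₃ ∧ PairHole G P₂ P₃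

/-- `G` contains a pyramid. -/
def HasPyramid (G : SimpleGraph V) : Prop :=
  ∃ (a b₁ b₂ b₃ : V) (P₁ : G.Walk a b₁) (P₂ : G.Walk a b₂) (P₃ : G.Walk a b₃),
    G.Adj b₁ b₂ ∧ G.Adj b₁ b₃ ∧ G.Adj b₂ b₃ ∧
    a ≠ b₁ ∧ a ≠ b₂ ∧ a ≠ b₃ ∧
    P₁.IsPath ∧ P₂.IsPath ∧ P₃.IsPath ∧
    PairHole G P₁ P₂ ∧ PairHole G P₁ P₃ ∧ PairHole G P₂ P₃

/-- `G` contains a prism. -/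
def HasPrism (G : SimpleGraph V) : Prop :=
  ∃ (a₁ a₂ a₃ b₁ b₂ b₃ : V) (P₁ : G.Walk a₁ b₁) (P₂ : G.Walk a₂ b₂) (P₃ : G.Walk a₃ b₃),
    G.Adj a₁ a₂ ∧ G.Adj a₁ a₃ ∧ G.Adj a₂ a₃ ∧
    G.Adj b₁ b₂ ∧ G.Adj b₁ b₃ ∧ G.Adj b₂ b₃ ∧
    ({a₁, a₂, a₃} : Set V) ∩ {b₁, b₂, b₃} = ∅ ∧
    P₁.IsPath ∧ P₂.IsPath ∧ P₃.IsPath ∧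
    PairHole G P₁ P₂ ∧ PairHole G P₁ P₃ ∧ PairHole G P₂ P₃

/-- The neighbors of `v` inside the set `S`. -/
def nbrsIn (G : SimpleGraph V) (S : Set V) (v : V) : Set V :=
  {u | u ∈ S ∧ G.Adj v u}

/-- `(S, v)` is a wheel of `G`: `S` is a hole and `v ∉ S` has at least 3 neighbors in `S`. -/
def IsWheel (G : SimpleGraph V) (S : Set V) (v : V) : Prop :=
  IsHoleSet G S ∧ v ∉ S ∧ 3 ≤ (nbrsIn G S v).ncard

/-- `(S, v)` is an even wheel of `G`. -/
def IsEvenWheel (G : SimpleGraph V) (S : Set V) (v : V) : Prop :=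
  IsWheel G S v ∧ Even (nbrsIn G S v).ncard

def HasWheel (G : SimpleGraph V) : Prop := ∃ (S : Set V) (v : V), IsWheel G S v

def HasEvenWheel (G : SimpleGraph V) : Prop := ∃ (S : Set V) (v : V), IsEvenWheel G S v

/-- A bug: a wheel whose hub has exactly three neighbors in the hole,
exactly two of which are adjacent. -/
def IsBug (G : SimpleGraph V) (S : Set V) (v : V) : Prop :=
  IsWheel G S v ∧ ∃ x y z : V, x ≠ y ∧ x ≠ z ∧ y ≠ z ∧
    nbrsIn G S v = {x, y, z} ∧ G.Adj x y ∧ ¬ G.Adj x z ∧ ¬ G.Adj y z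

/-- A twin wheel: the neighbors of the hub in the hole induce a path of length two. -/
def IsTwinWheel (G : SimpleGraph V) (S : Set V) (v : V) : Prop :=
  IsWheel G S v ∧ ∃ x y z : V, x ≠ y ∧ x ≠ z ∧ y ≠ z ∧
    nbrsIn G S v = {x, y, z} ∧ G.Adj x y ∧ G.Adj y z ∧ ¬ G.Adj x z

/-- A universal wheel: the hub is adjacent to every vertex of the hole. -/
def IsUniversalWheel (G : SimpleGraph V) (S : Set V) (v : V) : Prop :=
  IsWheel G S v ∧ ∀ u ∈ S, G.Adj v u

/-- `G` is a member of the class 𝒞 of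
(C4, diamond, theta, pyramid, prism, even wheel)-free graphs. -/
def InC (G : SimpleGraph V) : Prop :=
  Free G (cycleGraph 4) ∧ Free G diamond ∧ ¬ HasTheta G ∧ ¬ HasPyramid G ∧
    ¬ HasPrism G ∧ ¬ HasEvenWheel G

/-- The independence number of `G`. -/
noncomputable def indepNum (G : SimpleGraph V) : ℕ :=
  sSup {n | ∃ S : Set V, (S.Pairwise fun u v => ¬ G.Adj u v) ∧ S.ncard = n}

/-- The clique number of `G`. -/
noncomputable def cliqueNum (G : SimpleGraph V) : ℕ :=
  sSup {n | ∃ S : Set V, G.IsClique S ∧ S.ncard = n}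

/-- The (vertex) clique cover number of `G`: the minimum number of parts in a
partition of the vertex set of `G` into cliques. -/
noncomputable def cliqueCoverNum (G : SimpleGraph V) : ℕ :=
  sInf {n | ∃ F : Finset (Set V), F.card = n ∧ (∀ C ∈ F, G.IsClique C) ∧
    ∀ v : V, ∃! C : Set V, C ∈ F ∧ v ∈ C}

/-- A tree decomposition of `G`. -/
structure TreeDecomp (G : SimpleGraph V) where
  ι : Type
  tree : SimpleGraph ι
  tree_acyclic : tree.IsAcyclic
  tree_connected : tree.Connected
  bag : ι → Set V
  bag_cover : ∀ v : V, ∃ t, v ∈ bag t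
  bag_edge : ∀ ⦃u v : V⦄, G.Adj u v → ∃ t, u ∈ bag t ∧ v ∈ bag t
  bag_subtree : ∀ v : V, (tree.induce {t | v ∈ bag t}).Connected

/-- The treewidth of `G`: the minimum over tree decompositions of (max bag size − 1). -/
noncomputable def treewidth (G : SimpleGraph V) : ℕ :=
  sInf {k | ∃ D : TreeDecomp G, ∀ t, (D.bag t).ncard ≤ k + 1}

/-- The tree independence number of `G`. -/
noncomputable def treeIndepNum (G : SimpleGraph V) : ℕ :=
  sInf {k | ∃ D : TreeDecomp G, ∀ t, indepNum (G.induce (D.bag t)) ≤ k}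

/-- The tree clique cover number of `G`. -/
noncomputable def treeCliqueCoverNum (G : SimpleGraph V) : ℕ :=
  sInf {k | ∃ D : TreeDecomp G, ∀ t, cliqueCoverNum (G.induce (D.bag t)) ≤ k}

/-- A weight function on a finite graph: values in `[0,1]` summing to `1`. -/
def IsWeightFn [Fintype V] (w : V → ℝ) : Prop :=
  (∀ v, 0 ≤ w v ∧ w v ≤ 1) ∧ ∑ v, w v = 1

/-- The weight of a set of vertices. -/
noncomputable def wSet (w : V → ℝ) (S : Set V) : ℝ := ∑ᶠ x ∈ S, w x

/-- `X` is a `(w, c)`-balanced separator of `G`: every connected component of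
`G − X` has weight at most `c`. -/
def IsBalancedSep (G : SimpleGraph V) (w : V → ℝ) (c : ℝ) (X : Set V) : Prop :=
  ∀ D : (G.induce Xᶜ).ConnectedComponent, wSet w (Subtype.val '' D.supp) ≤ c

/-- `G` has a clique cutset: a clique `C` such that `G − C` is disconnected. -/
def HasCliqueCutset (G : SimpleGraph V) : Prop :=
  ∃ C : Set V, G.IsClique C ∧ ¬ (G.induce Cᶜ).Preconnected

/-- The closed neighborhood of `v`. -/
def closedNbhd (G : SimpleGraph V) (v : V) : Set V := insert v (G.neighborSet v)

/-- The (open) neighborhood of a set `S`: vertices outside `S` with a neighbor in `S`. -/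
def setNbhd (G : SimpleGraph V) (S : Set V) : Set V :=
  {v | v ∉ S ∧ ∃ u ∈ S, G.Adj v u}

/-- `(A, C, B)` is a separation of `G`. -/
def IsSeparation (G : SimpleGraph V) (A C B : Set V) : Prop :=
  A ∪ C ∪ B = Set.univ ∧ Disjoint A C ∧ Disjoint A B ∧ Disjoint C B ∧
    ∀ a ∈ A, ∀ b ∈ B, ¬ G.Adj a b

/-- `v` is a balanced vertex with respect to `w`: every connected component of
`G − N[v]` has weight at most `1/2`. -/
def IsBalancedVtx (G : SimpleGraph V) (w : V → ℝ) (v : V) : Prop :=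
  ∀ D : (G.induce (closedNbhd G v)ᶜ).ConnectedComponent,
    wSet w (Subtype.val '' D.supp) ≤ 1 / 2


structure Cyc {V : Type} (G : SimpleGraph V) (n : ℕ) (h : ℕ → V) : Prop where
  four : 4 ≤ n
  inj : ∀ i j, i < n → j < n → h i = h j → i = j
  adj : ∀ i j, i < n → j < n →
    (G.Adj (h i) (h j) ↔ j = i + 1 ∨ i = j + 1 ∨ (i = 0 ∧ j = n - 1) ∨ (j = 0 ∧ i = n - 1))

structure IPath {V : Type} (G : SimpleGraph V) (k : ℕ) (p : ℕ → V) : Prop where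
  inj : ∀ i j, i ≤ k → j ≤ k → p i = p j → i = j
  adj : ∀ i j, i ≤ k → j ≤ k → (G.Adj (p i) (p j) ↔ j = i + 1 ∨ i = j + 1)

theorem cyc_hole {V : Type} {G : SimpleGraph V} {n : ℕ} {h : ℕ → V} (c : Cyc G n h)
    (S : Set V) (hS : ∀ v, v ∈ S ↔ ∃ i < n, h i = v) : IsHoleSet G S := by
  refine ⟨n, c.four, ⟨RelIso.symm ?_⟩⟩
  let f : Fin n → S := fun i => ⟨h i, (hS _).2 ⟨i, i.2, rfl⟩⟩
  have hf : Function.Bijective f := by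
    constructor
    · intro i j hij
      exact Fin.ext (c.inj _ _ i.2 j.2 (congrArg Subtype.val hij))
    · rintro ⟨v, hv⟩
      obtain ⟨i, hi, e⟩ := (hS v).1 hv
      exact ⟨⟨i, hi⟩, Subtype.ext e⟩
  refine ⟨Equiv.ofBijective f hf, ?_⟩
  rintro ⟨i, hi⟩ ⟨j, hj⟩
  have h4 := c.four
  change G.Adj (h i) (h j) ↔ _
  rw [c.adj i j hi hj, cycleGraph_adj', Fin.sub_def, Fin.sub_def]
  simp only
  rcases lt_trichotomy i j with hlt | heq | hlt
  · have e1 : (n - j + i) % n = n - j + i := Nat.mod_eq_of_lt (by omega)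
    have e2 : (n - i + j) % n = j - i := by
      rw [show n - i + j = (j - i) + n by omega, Nat.add_mod_right]
      exact Nat.mod_eq_of_lt (by omega)
    rw [e1, e2]; omega
  · subst heq
    have e1 : (n - i + i) % n = 0 := by
      rw [show n - i + i = n by omega]; exact Nat.mod_self n
    rw [e1]; omega
  · have e1 : (n - i + j) % n = n - i + j := Nat.mod_eq_of_lt (by omega)
    have e2 : (n - j + i) % n = i - j := by
      rw [show n - j + i = (i - j) + n by omega, Nat.add_mod_right]
      exact Nat.mod_eq_of_lt (by omega)
    rw [e1, e2]; omega

theorem glue {V : Type} {G : SimpleGraph V} {m k : ℕ} {a p : ℕ → V}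
    (ha : IPath G m a) (hp : IPath G k p) (hm : 1 ≤ m) (hmk : 2 ≤ m + k)
    (hd : ∀ i j, i ≤ m → j ≤ k → a i ≠ p j)
    (hadj : ∀ i j, i ≤ m → j ≤ k → (G.Adj (a i) (p j) ↔ (i = 0 ∧ j = 0) ∨ (i = m ∧ j = k))) :
    ∃ n c, Cyc G n c ∧
      ∀ v, (∃ i < n, c i = v) ↔ (∃ i ≤ m, a i = v) ∨ (∃ j ≤ k, p j = v) := by
  refine ⟨m + k + 2, fun i => if i ≤ m then a i else p (k - (i - m - 1)), ⟨by omega, ?_, ?_⟩, ?_⟩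
  · intro i j hi hj
    split_ifs with h1 h2 h2
    · intro e; exact ha.inj _ _ h1 h2 e
    · intro e; exact absurd e (hd _ _ h1 (by omega))
    · intro e; exact absurd e.symm (hd _ _ h2 (by omega))
    · intro e; have := hp.inj _ _ (by omega) (by omega) e; omega
  · intro i j hi hj
    split_ifs with h1 h2 h2
    · rw [ha.adj _ _ h1 h2]; omega
    · rw [hadj _ _ h1 (by omega)]; omega
    · rw [G.adj_comm, hadj _ _ h2 (by omega)]; omega
    · rw [hp.adj _ _ (by omega) (by omega)]; omega
  · intro v
    constructor
    · rintro ⟨i, hi, rfl⟩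
      by_cases h : i ≤ m
      · left; exact ⟨i, h, by simp [h]⟩
      · right; exact ⟨k - (i - m - 1), by omega, by simp [h]⟩
    · rintro (⟨i, hi, rfl⟩ | ⟨j, hj, rfl⟩)
      · exact ⟨i, by omega, by simp [hi]⟩
      · refine ⟨m + 1 + (k - j), by omega, ?_⟩
        have : ¬ (m + 1 + (k - j) ≤ m) := by omega
        simp only [this, if_false]
        congr 1; omega

theorem Cyc.arc {V : Type} {G : SimpleGraph V} {n : ℕ} {h : ℕ → V} (c : Cyc G n h)
    {m : ℕ} (hm : m + 2 ≤ n) : IPath G m h :=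
  ⟨fun i j hi hj => c.inj i j (by omega) (by omega),
   fun i j hi hj => by rw [c.adj i j (by omega) (by omega)]; omega⟩

theorem Cyc.refl0 {V : Type} {G : SimpleGraph V} {n : ℕ} {h : ℕ → V} (c : Cyc G n h) :
    Cyc G n (fun i => if i = 0 then h 0 else h (n - i)) := by
  have := c.four
  refine ⟨c.four, ?_, ?_⟩
  · intro i j hi hj
    split_ifs <;> intro e <;> have := c.inj _ _ (by omega) (by omega) e <;> omega
  · intro i j hi hj
    split_ifs <;> rw [c.adj _ _ (by omega) (by omega)] <;> omega

theorem Cyc.refl1 {V : Type} {G : SimpleGraph V} {n : ℕ} {h : ℕ → V} (c : Cyc G n h) :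
    Cyc G n (fun i => h (n - 1 - i)) := by
  have := c.four
  refine ⟨c.four, ?_, ?_⟩
  · intro i j hi hj e
    have := c.inj _ _ (by omega) (by omega) e; omega
  · intro i j hi hj
    rw [c.adj _ _ (by omega) (by omega)]; omega

theorem Cyc.rot {V : Type} {G : SimpleGraph V} {n : ℕ} {h : ℕ → V} (c : Cyc G n h)
    (s : ℕ) (hs : s < n) :
    Cyc G n (fun i => if i + s < n then h (i + s) else h (i + s - n)) := by
  have := c.four
  refine ⟨c.four, ?_, ?_⟩
  · intro i j hi hj
    split_ifs <;> intro e <;> have := c.inj _ _ (by omega) (by omega) e <;> omega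
  · intro i j hi hj
    split_ifs <;> rw [c.adj _ _ (by omega) (by omega)] <;> omega

def InR {V : Type} (n : ℕ) (h : ℕ → V) (v : V) : Prop := ∃ i < n, h i = v

theorem Cyc.start {V : Type} {G : SimpleGraph V} {n : ℕ} {h : ℕ → V} (c : Cyc G n h)
    {x : V} (hx : InR n h x) :
    ∃ h', Cyc G n h' ∧ (∀ v, InR n h' v ↔ InR n h v) ∧ h' 0 = x := by
  obtain ⟨s, hs, rfl⟩ := hx
  refine ⟨_, c.rot s hs, ?_, by simp [hs]⟩
  intro v
  constructor
  · rintro ⟨i, hi, rfl⟩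
    by_cases h1 : i + s < n
    · exact ⟨i + s, h1, by simp [h1]⟩
    · exact ⟨i + s - n, by omega, by simp [h1]⟩
  · rintro ⟨i, hi, rfl⟩
    by_cases h1 : s ≤ i
    · exact ⟨i - s, by omega, by simp [h1, hi]⟩
    · refine ⟨i + n - s, by omega, ?_⟩
      have h2 : ¬ (i + n - s + s < n) := by omega
      simp only [h2, if_false]
      congr 1; omega

theorem Cyc.start2 {V : Type} {G : SimpleGraph V} {n : ℕ} {h : ℕ → V} (c : Cyc G n h)
    {x y : V} (hx : InR n h x) (hy : InR n h y) (hxy : G.Adj x y) :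
    ∃ h', Cyc G n h' ∧ (∀ v, InR n h' v ↔ InR n h v) ∧ h' 0 = x ∧ h' (n - 1) = y := by
  obtain ⟨h', c', hr, rfl⟩ := c.start hx
  obtain ⟨j, hj, rfl⟩ := (hr y).2 hy
  have h4 := c'.four
  rw [c'.adj _ _ (by omega) hj] at hxy
  by_cases hj1 : j = n - 1
  · subst hj1; exact ⟨h', c', hr, rfl, rfl⟩
  have : j = 1 := by omega
  subst this
  refine ⟨_, c'.refl0, ?_, by simp, ?_⟩
  · intro v
    rw [← hr v]
    constructor
    · rintro ⟨i, hi, rfl⟩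
      by_cases h1 : i = 0
      · exact ⟨0, by omega, by simp [h1]⟩
      · exact ⟨n - i, by omega, by simp [h1]⟩
    · rintro ⟨i, hi, rfl⟩
      by_cases h1 : i = 0
      · exact ⟨0, by omega, by simp [h1]⟩
      · refine ⟨n - i, by omega, ?_⟩
        have h2 : ¬ (n - i = 0) := by omega
        simp only [h2, if_false]
        congr 1; omega
  · have h2 : ¬ (n - 1 = 0) := by omega
    simp only [h2, if_false]
    congr 1; omega

theorem IPath.walk {V : Type} {G : SimpleGraph V} {k : ℕ} {p : ℕ → V} (hp : IPath G k p) :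
    ∃ w : G.Walk (p 0) (p k), w.IsPath ∧ ∀ v, v ∈ w.support ↔ ∃ i ≤ k, p i = v := by
  induction k with
  | zero => exact ⟨.nil, by simp, by simp [eq_comm]⟩
  | succ k ih =>
    obtain ⟨w, hw, hs⟩ := ih ⟨fun i j hi hj => hp.inj i j (by omega) (by omega),
      fun i j hi hj => hp.adj i j (by omega) (by omega)⟩
    have ha : G.Adj (p k) (p (k+1)) := (hp.adj k (k+1) (by omega) (by omega)).2 (by omega)
    refine ⟨w.concat ha, ?_, ?_⟩
    · rw [Walk.concat_isPath_iff]
      refine ⟨hw, ?_⟩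
      rw [hs]
      rintro ⟨i, hi, e⟩
      have := hp.inj _ _ (by omega) (by omega) e
      omega
    · intro v
      rw [Walk.support_concat, List.mem_append, hs]
      constructor
      · rintro (⟨i, hi, rfl⟩ | h)
        · exact ⟨i, by omega, rfl⟩
        · exact ⟨k+1, le_rfl, by simpa [eq_comm] using h⟩
      · rintro ⟨i, hi, rfl⟩
        by_cases h : i = k + 1
        · subst h; right; simp
        · left; exact ⟨i, by omega, rfl⟩

theorem absorb1 {V : Type} {P : V → Prop} {R : Prop} {x v : V} (hx : P x) :
    (P v ∨ v = x ∨ R) ↔ (P v ∨ R) := by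
  constructor
  · rintro (h | rfl | h)
    · exact Or.inl h
    · exact Or.inl hx
    · exact Or.inr h
  · rintro (h | h)
    · exact Or.inl h
    · exact Or.inr (Or.inr h)

theorem absorb2 {V : Type} {P : V → Prop} {R : Prop} {x y v : V} (hx : P x) (hy : P y) :
    (P v ∨ v = x ∨ R ∨ v = y) ↔ (P v ∨ R) := by
  rw [absorb1 hx]
  constructor
  · rintro (h | h | rfl)
    · exact Or.inl h
    · exact Or.inr h
    · exact Or.inl hy
  · rintro (h | h)
    · exact Or.inl h
    · exact Or.inr (Or.inl h)

/-- The hole obtained from a path `p` and an arc of a hole. -/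
theorem glue_hole {V : Type} {G : SimpleGraph V} {m k : ℕ} {a p : ℕ → V}
    (ha : IPath G m a) (hp : IPath G k p) (hm : 1 ≤ m) (hmk : 2 ≤ m + k)
    (hd : ∀ i j, i ≤ m → j ≤ k → a i ≠ p j)
    (hadj : ∀ i j, i ≤ m → j ≤ k → (G.Adj (a i) (p j) ↔ (i = 0 ∧ j = 0) ∨ (i = m ∧ j = k)))
    (S : Set V) (hS : ∀ v, v ∈ S ↔ (∃ i ≤ m, a i = v) ∨ (∃ j ≤ k, p j = v)) :
    IsHoleSet G S := by
  obtain ⟨n, c, hc, hr⟩ := glue ha hp hm hmk hd hadj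
  exact cyc_hole hc S (fun v => by rw [hS, hr])

theorem theta_case {V : Type} {G : SimpleGraph V} {n k s : ℕ} {h p : ℕ → V}
    (c : Cyc G n h) (hp : IPath G k p) (hs : 2 ≤ s) (hs' : s + 2 ≤ n)
    (hd : ∀ i j, i < n → j ≤ k → h i ≠ p j)
    (hadj : ∀ i j, i < n → j ≤ k → (G.Adj (h i) (p j) ↔ (i = 0 ∧ j = 0) ∨ (i = s ∧ j = k))) :
    HasTheta G := by
  have h4 := c.four
  have a1 : IPath G s h := c.arc hs'
  have a2 : IPath G (n - s) (fun i => if i = 0 then h 0 else h (n - i)) := c.refl0.arc (by omega)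
  obtain ⟨w1, hw1, s1⟩ := a1.walk
  obtain ⟨w2, hw2, s2⟩ := a2.walk
  obtain ⟨w3, hw3, s3⟩ := hp.walk
  have e2 : (fun i => if i = 0 then h 0 else h (n - i)) (n - s) = h s := by
    have : ¬ (n - s = 0) := by omega
    simp only [this, if_false]; congr 1; omega
  have x0 : G.Adj (h 0) (p 0) := (hadj 0 0 (by omega) (by omega)).2 (by omega)
  have y0 : G.Adj (p k) (h s) := ((hadj s k (by omega) (by omega)).2 (by omega)).symm
  refine ⟨h 0, h s, w1, w2.copy rfl e2, Walk.cons x0 (w3.concat y0), ?_, ?_, hw1, ?_, ?_, ?_, ?_, ?_⟩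
  · intro e; have := c.inj _ _ (by omega) (by omega) e; omega
  · rw [c.adj _ _ (by omega) (by omega)]; omega
  · simpa using hw2
  · rw [Walk.cons_isPath_iff, Walk.concat_isPath_iff]
    refine ⟨⟨hw3, ?_⟩, ?_⟩
    · rw [s3]; rintro ⟨j, hj, e⟩; exact hd s j (by omega) hj e.symm
    · rw [Walk.support_concat, List.mem_append, s3]
      rintro (⟨j, hj, e⟩ | e)
      · exact hd 0 j (by omega) hj e.symm
      · have := c.inj 0 s (by omega) (by omega) (by simpa using e); omega
  · refine cyc_hole c _ (fun v => ?_)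
    simp only [Set.mem_ofPred_eq, Walk.support_copy, s1, s2]
    constructor
    · rintro (⟨i, hi, rfl⟩ | ⟨i, hi, rfl⟩)
      · exact ⟨i, by omega, rfl⟩
      · split_ifs
        · exact ⟨0, by omega, rfl⟩
        · exact ⟨n - i, by omega, rfl⟩
    · rintro ⟨i, hi, rfl⟩
      by_cases his : i ≤ s
      · left; exact ⟨i, his, rfl⟩
      · right
        refine ⟨n - i, by omega, ?_⟩
        have : ¬ (n - i = 0) := by omega
        simp only [this, if_false]; congr 1; omega
  · refine glue_hole a1 hp (by omega) (by omega) (fun i j hi hj => hd i j (by omega) hj)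
      (fun i j hi hj => hadj i j (by omega) hj) _ (fun v => ?_)
    simp only [Set.mem_ofPred_eq, Walk.support_cons, Walk.support_concat,
      List.mem_append, List.mem_cons, List.not_mem_nil, or_false, s1, s3]
    have m0 : ∃ i ≤ s, h i = h 0 := ⟨0, by omega, rfl⟩
    have ms : ∃ i ≤ s, h i = h s := ⟨s, by omega, rfl⟩
    exact absorb2 (P := fun v => ∃ i ≤ s, h i = v) m0 ms
  · refine glue_hole a2 hp (by omega) (by omega) (fun i j hi hj => ?_)
      (fun i j hi hj => ?_) _ (fun v => ?_)
    · split_ifs <;> apply hd <;> omega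
    · split_ifs <;> rw [hadj _ _ (by omega) hj] <;> omega
    simp only [Set.mem_ofPred_eq, Walk.support_cons, Walk.support_concat,
      List.mem_append, List.mem_cons, List.not_mem_nil, or_false, Walk.support_copy, s2, s3]
    have m0 : ∃ i ≤ n - s, (if i = 0 then h 0 else h (n - i)) = h 0 := ⟨0, by omega, rfl⟩
    have ms : ∃ i ≤ n - s, (if i = 0 then h 0 else h (n - i)) = h s := ⟨n - s, by omega, e2⟩
    exact absorb2 (P := fun v => ∃ i ≤ n - s, (if i = 0 then h 0 else h (n - i)) = v) m0 ms

theorem pyramid_case {V : Type} {G : SimpleGraph V} {n k s : ℕ} {h p : ℕ → V}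
    (c : Cyc G n h) (hp : IPath G k p) (hk : 1 ≤ k) (hs : 1 ≤ s) (hs' : s + 2 ≤ n)
    (hd : ∀ i j, i < n → j ≤ k → h i ≠ p j)
    (hadj : ∀ i j, i < n → j ≤ k →
      (G.Adj (h i) (p j) ↔ (i = 0 ∧ j = 0) ∨ (i = s ∧ j = k) ∨ (i = s + 1 ∧ j = k))) :
    HasPyramid G := by
  have h4 := c.four
  have a1 : IPath G s h := c.arc hs'
  have a2 : IPath G (n - s - 1) (fun i => if i = 0 then h 0 else h (n - i)) :=
    c.refl0.arc (by omega)
  obtain ⟨w1, hw1, s1⟩ := a1.walk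
  obtain ⟨w2, hw2, s2⟩ := a2.walk
  obtain ⟨w3, hw3, s3⟩ := hp.walk
  have e2 : (fun i => if i = 0 then h 0 else h (n - i)) (n - s - 1) = h (s + 1) := by
    have : ¬ (n - s - 1 = 0) := by omega
    simp only [this, if_false]; congr 1; omega
  have x0 : G.Adj (h 0) (p 0) := (hadj 0 0 (by omega) (by omega)).2 (by omega)
  refine ⟨h 0, h s, h (s + 1), p k, w1, w2.copy rfl e2, Walk.cons x0 w3,
    ?_, ?_, ?_, ?_, ?_, ?_, hw1, ?_, ?_, ?_, ?_, ?_⟩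
  · rw [c.adj _ _ (by omega) (by omega)]; omega
  · rw [hadj _ _ (by omega) (by omega)]; omega
  · rw [hadj _ _ (by omega) (by omega)]; omega
  · intro e; have := c.inj _ _ (by omega) (by omega) e; omega
  · intro e; have := c.inj _ _ (by omega) (by omega) e; omega
  · exact hd _ _ (by omega) (by omega)
  · simpa using hw2
  · rw [Walk.cons_isPath_iff]
    refine ⟨hw3, ?_⟩
    rw [s3]; rintro ⟨j, hj, e⟩; exact hd 0 j (by omega) hj e.symm
  · refine cyc_hole c _ (fun v => ?_)
    simp only [Set.mem_ofPred_eq, Walk.support_copy, s1, s2]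
    constructor
    · rintro (⟨i, hi, rfl⟩ | ⟨i, hi, rfl⟩)
      · exact ⟨i, by omega, rfl⟩
      · split_ifs
        · exact ⟨0, by omega, rfl⟩
        · exact ⟨n - i, by omega, rfl⟩
    · rintro ⟨i, hi, rfl⟩
      by_cases his : i ≤ s
      · left; exact ⟨i, his, rfl⟩
      · right
        refine ⟨n - i, by omega, ?_⟩
        have : ¬ (n - i = 0) := by omega
        simp only [this, if_false]; congr 1; omega
  · refine glue_hole a1 hp (by omega) (by omega) (fun i j hi hj => hd i j (by omega) hj)
      (fun i j hi hj => by rw [hadj i j (by omega) hj]; omega) _ (fun v => ?_)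
    simp only [Set.mem_ofPred_eq, Walk.support_cons, List.mem_cons, s1, s3]
    have m0 : ∃ i ≤ s, h i = h 0 := ⟨0, by omega, rfl⟩
    exact absorb1 (P := fun v => ∃ i ≤ s, h i = v) m0
  · refine glue_hole a2 hp (by omega) (by omega) (fun i j hi hj => ?_)
      (fun i j hi hj => ?_) _ (fun v => ?_)
    · split_ifs <;> apply hd <;> omega
    · split_ifs <;> rw [hadj _ _ (by omega) hj] <;> omega
    simp only [Set.mem_ofPred_eq, Walk.support_cons, List.mem_cons, Walk.support_copy, s2, s3]
    have m0 : ∃ i ≤ n - s - 1, (if i = 0 then h 0 else h (n - i)) = h 0 := ⟨0, by omega, rfl⟩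
    exact absorb1 (P := fun v => ∃ i ≤ n - s - 1, (if i = 0 then h 0 else h (n - i)) = v) m0

theorem prism_case {V : Type} {G : SimpleGraph V} {n k s : ℕ} {h p : ℕ → V}
    (c : Cyc G n h) (hp : IPath G k p) (hk : 1 ≤ k) (hs : 1 ≤ s) (hs' : s + 3 ≤ n)
    (hd : ∀ i j, i < n → j ≤ k → h i ≠ p j)
    (hadj : ∀ i j, i < n → j ≤ k →
      (G.Adj (h i) (p j) ↔ (i = 0 ∧ j = 0) ∨ (i = n - 1 ∧ j = 0) ∨
        (i = s ∧ j = k) ∨ (i = s + 1 ∧ j = k))) :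
    HasPrism G := by
  have h4 := c.four
  have a1 : IPath G s h := c.arc (by omega)
  have a2 : IPath G (n - s - 2) (fun i => h (n - 1 - i)) := c.refl1.arc (by omega)
  obtain ⟨w1, hw1, s1⟩ := a1.walk
  obtain ⟨w2, hw2, s2⟩ := a2.walk
  obtain ⟨w3, hw3, s3⟩ := hp.walk
  have e1 : (fun i => h (n - 1 - i)) 0 = h (n - 1) := rfl
  have e2 : (fun i => h (n - 1 - i)) (n - s - 2) = h (s + 1) := by
    simp only; congr 1; omega
  refine ⟨h 0, h (n - 1), p 0, h s, h (s + 1), p k, w1, w2.copy e1 e2, w3,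
    ?_, ?_, ?_, ?_, ?_, ?_, ?_, hw1, ?_, hw3, ?_, ?_, ?_⟩
  · rw [c.adj _ _ (by omega) (by omega)]; omega
  · rw [hadj _ _ (by omega) (by omega)]; omega
  · rw [hadj _ _ (by omega) (by omega)]; omega
  · rw [c.adj _ _ (by omega) (by omega)]; omega
  · rw [hadj _ _ (by omega) (by omega)]; omega
  · rw [hadj _ _ (by omega) (by omega)]; omega
  · ext v
    simp only [Set.mem_inter_iff, Set.mem_insert_iff, Set.mem_singleton_iff,
      Set.mem_empty_iff_false, iff_false]
    rintro ⟨rfl | rfl | rfl, e | e | e⟩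
    · have := c.inj _ _ (by omega) (by omega) e; omega
    · have := c.inj _ _ (by omega) (by omega) e; omega
    · exact hd _ _ (by omega) (by omega) e
    · have := c.inj _ _ (by omega) (by omega) e; omega
    · have := c.inj _ _ (by omega) (by omega) e; omega
    · exact hd _ _ (by omega) (by omega) e
    · exact hd _ _ (by omega) (by omega) e.symm
    · exact hd _ _ (by omega) (by omega) e.symm
    · have := hp.inj _ _ (by omega) (by omega) e; omega
  · simpa using hw2
  · refine cyc_hole c _ (fun v => ?_)
    simp only [Set.mem_ofPred_eq, Walk.support_copy, s1, s2]
    constructor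
    · rintro (⟨i, hi, rfl⟩ | ⟨i, hi, rfl⟩)
      · exact ⟨i, by omega, rfl⟩
      · exact ⟨n - 1 - i, by omega, rfl⟩
    · rintro ⟨i, hi, rfl⟩
      by_cases his : i ≤ s
      · left; exact ⟨i, his, rfl⟩
      · right
        refine ⟨n - 1 - i, by omega, ?_⟩
        congr 1; omega
  · refine glue_hole a1 hp (by omega) (by omega) (fun i j hi hj => hd i j (by omega) hj)
      (fun i j hi hj => by rw [hadj i j (by omega) hj]; omega) _ (fun v => ?_)
    simp only [Set.mem_ofPred_eq, s1, s3]
  · by_cases hm : n - s - 2 = 0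
    · omega
    refine glue_hole a2 hp (by omega) (by omega) (fun i j hi hj => ?_)
      (fun i j hi hj => ?_) _ (fun v => ?_)
    · apply hd <;> omega
    · rw [hadj _ _ (by omega) hj]; omega
    simp only [Set.mem_ofPred_eq, Walk.support_copy, s2, s3]

theorem wheel_case {V : Type} [Finite V] {G : SimpleGraph V} {n k j₀ : ℕ} {h p : ℕ → V}
    (c : Cyc G n h) (hp : IPath G k p) (hk : 1 ≤ k)
    (hd : ∀ i j, i < n → j ≤ k → h i ≠ p j)
    (hadj : ∀ i j, i < n → 0 < i → j ≤ k →
      (G.Adj (h i) (p j) ↔ (i = 1 ∧ j = 0) ∨ (i = n - 1 ∧ j = k)))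
    (hj : j₀ ≤ k) (hz : G.Adj (h 0) (p j₀)) :
    HasWheel G := by
  have h4 := c.four
  have a1 : IPath G (n - 2) (fun i => h (i + 1)) :=
    ⟨fun i j hi hj e => by have := c.inj _ _ (by omega) (by omega) e; omega,
     fun i j hi hj => by rw [c.adj _ _ (by omega) (by omega)]; omega⟩
  refine ⟨{v | (∃ i ≤ n - 2, h (i + 1) = v) ∨ (∃ j ≤ k, p j = v)}, h 0, ?_, ?_, ?_⟩
  · refine glue_hole a1 hp (by omega) (by omega) (fun i j hi hj => hd _ j (by omega) hj)
      (fun i j hi hj => by rw [hadj _ j (by omega) (by omega) hj]; omega) _ (fun v => ?_)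
    rfl
  · rintro (⟨i, hi, e⟩ | ⟨j, hj, e⟩)
    · have := c.inj _ _ (by omega) (by omega) e; omega
    · exact hd 0 j (by omega) hj e.symm
  · have hsub : ({h 1, h (n - 1), p j₀} : Set V) ⊆ nbrsIn G
        {v | (∃ i ≤ n - 2, h (i + 1) = v) ∨ (∃ j ≤ k, p j = v)} (h 0) := by
      rintro v (rfl | rfl | rfl)
      · exact ⟨Or.inl ⟨0, by omega, rfl⟩, by rw [c.adj _ _ (by omega) (by omega)]; omega⟩
      · exact ⟨Or.inl ⟨n - 2, by omega, by congr 1; omega⟩,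
          by rw [c.adj _ _ (by omega) (by omega)]; omega⟩
      · exact ⟨Or.inr ⟨j₀, hj, rfl⟩, hz⟩
    have h3 : ({h 1, h (n - 1), p j₀} : Set V).ncard = 3 := by
      rw [Set.ncard_eq_three]
      refine ⟨_, _, _, ?_, ?_, ?_, rfl⟩
      · intro e; have := c.inj _ _ (by omega) (by omega) e; omega
      · exact hd _ _ (by omega) hj
      · exact hd _ _ (by omega) hj
    rw [← h3]
    exact Set.ncard_le_ncard hsub (Set.toFinite _)

theorem Cyc.eq_iff {V : Type} {G : SimpleGraph V} {n : ℕ} {h : ℕ → V} (c : Cyc G n h)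
    {i j : ℕ} (hi : i < n) (hj : j < n) : h i = h j ↔ i = j :=
  ⟨c.inj i j hi hj, fun e => by rw [e]⟩

theorem Cyc.no_triangle {V : Type} {G : SimpleGraph V} {n : ℕ} {h : ℕ → V} (c : Cyc G n h)
    {x y z : V} (hx : InR n h x) (hy : InR n h y) (hz : InR n h z)
    (hxy : G.Adj x y) (hxz : G.Adj x z) (hyz : G.Adj y z) : False := by
  obtain ⟨i, hi, rfl⟩ := hx
  obtain ⟨j, hj, rfl⟩ := hy
  obtain ⟨l, hl, rfl⟩ := hz
  have h4 := c.four
  rw [c.adj _ _ hi hj] at hxy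
  rw [c.adj _ _ hi hl] at hxz
  rw [c.adj _ _ hj hl] at hyz
  omega

theorem IPath.rev {V : Type} {G : SimpleGraph V} {k : ℕ} {p : ℕ → V} (hp : IPath G k p) :
    IPath G k (fun j => p (k - j)) :=
  ⟨fun i j hi hj e => by have := hp.inj _ _ (by omega) (by omega) e; omega,
   fun i j hi hj => by rw [hp.adj _ _ (by omega) (by omega)]; omega⟩

theorem core_theta {V : Type} {G : SimpleGraph V} {n k : ℕ} {h p : ℕ → V}
    (c : Cyc G n h) (hp : IPath G k p) (hd : ∀ z, InR n h z → ∀ j ≤ k, z ≠ p j)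
    {x y : V} (hx : InR n h x) (hy : InR n h y) (hxy : x ≠ y) (hna : ¬ G.Adj x y)
    (hadj : ∀ z, InR n h z → ∀ j ≤ k, (G.Adj z (p j) ↔ (z = x ∧ j = 0) ∨ (z = y ∧ j = k))) :
    HasTheta G := by
  obtain ⟨h', c', hr, rfl⟩ := c.start hx
  obtain ⟨s, hs, rfl⟩ := (hr y).2 hy
  have h4 := c'.four
  rw [Ne, c'.eq_iff (by omega) hs] at hxy
  rw [c'.adj _ _ (by omega) hs] at hna
  refine theta_case c' hp (s := s) (by omega) (by omega)
    (fun i j hi hj => hd _ ((hr _).1 ⟨i, hi, rfl⟩) j hj) (fun i j hi hj => ?_)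
  rw [hadj _ ((hr _).1 ⟨i, hi, rfl⟩) j hj, c'.eq_iff hi (by omega), c'.eq_iff hi hs]

theorem core_pyramid {V : Type} {G : SimpleGraph V} {n k : ℕ} {h p : ℕ → V}
    (c : Cyc G n h) (hp : IPath G k p) (hk : 1 ≤ k) (hd : ∀ z, InR n h z → ∀ j ≤ k, z ≠ p j)
    {x y y' : V} (hx : InR n h x) (hy : InR n h y) (hy' : InR n h y')
    (hxy : x ≠ y) (hxy' : x ≠ y') (ha : G.Adj y y')
    (hadj : ∀ z, InR n h z → ∀ j ≤ k,
      (G.Adj z (p j) ↔ (z = x ∧ j = 0) ∨ (z = y ∧ j = k) ∨ (z = y' ∧ j = k))) :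
    HasPyramid G := by
  obtain ⟨h', c', hr, rfl⟩ := c.start hx
  obtain ⟨a, ha', rfl⟩ := (hr y).2 hy
  obtain ⟨b, hb', rfl⟩ := (hr y').2 hy'
  have h4 := c'.four
  rw [Ne, c'.eq_iff (by omega) ha'] at hxy
  rw [Ne, c'.eq_iff (by omega) hb'] at hxy'
  rw [c'.adj _ _ ha' hb'] at ha
  refine pyramid_case c' hp hk (s := min a b) (by omega) (by omega)
    (fun i j hi hj => hd _ ((hr _).1 ⟨i, hi, rfl⟩) j hj) (fun i j hi hj => ?_)
  rw [hadj _ ((hr _).1 ⟨i, hi, rfl⟩) j hj, c'.eq_iff hi (by omega), c'.eq_iff hi ha',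
    c'.eq_iff hi hb']
  omega

theorem core_prism {V : Type} {G : SimpleGraph V} {n k : ℕ} {h p : ℕ → V}
    (c : Cyc G n h) (hp : IPath G k p) (hk : 1 ≤ k) (hd : ∀ z, InR n h z → ∀ j ≤ k, z ≠ p j)
    {x x' y y' : V} (hx : InR n h x) (hx' : InR n h x') (hy : InR n h y) (hy' : InR n h y')
    (h1 : x ≠ y) (h2 : x ≠ y') (h3 : x' ≠ y) (h4 : x' ≠ y')
    (hax : G.Adj x x') (ha : G.Adj y y')
    (hadj : ∀ z, InR n h z → ∀ j ≤ k,
      (G.Adj z (p j) ↔ (z = x ∧ j = 0) ∨ (z = x' ∧ j = 0) ∨ (z = y ∧ j = k) ∨ (z = y' ∧ j = k))) :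
    HasPrism G := by
  obtain ⟨h', c', hr, rfl, rfl⟩ := c.start2 hx hx' hax
  obtain ⟨a, ha', rfl⟩ := (hr y).2 hy
  obtain ⟨b, hb', rfl⟩ := (hr y').2 hy'
  have hn := c'.four
  rw [Ne, c'.eq_iff (by omega) ha'] at h1 h3
  rw [Ne, c'.eq_iff (by omega) hb'] at h2 h4
  rw [c'.adj _ _ ha' hb'] at ha
  refine prism_case c' hp hk (s := min a b) (by omega) (by omega)
    (fun i j hi hj => hd _ ((hr _).1 ⟨i, hi, rfl⟩) j hj) (fun i j hi hj => ?_)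
  rw [hadj _ ((hr _).1 ⟨i, hi, rfl⟩) j hj, c'.eq_iff hi (by omega), c'.eq_iff hi (by omega),
    c'.eq_iff hi ha', c'.eq_iff hi hb']
  omega

theorem core_wheel {V : Type} [Finite V] {G : SimpleGraph V} {n k j₀ : ℕ} {h p : ℕ → V}
    (c : Cyc G n h) (hp : IPath G k p) (hk : 1 ≤ k) (hd : ∀ z, InR n h z → ∀ j ≤ k, z ≠ p j)
    {x y z : V} (hx : InR n h x) (hy : InR n h y) (hz : InR n h z) (hxy : x ≠ y)
    (hzx : G.Adj z x) (hzy : G.Adj z y)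
    (hadj : ∀ w, InR n h w → w ≠ z → ∀ j ≤ k,
      (G.Adj w (p j) ↔ (w = x ∧ j = 0) ∨ (w = y ∧ j = k)))
    (hj : j₀ ≤ k) (hzp : G.Adj z (p j₀)) :
    HasWheel G := by
  obtain ⟨h', c', hr, rfl, rfl⟩ := c.start2 hz hy hzy
  obtain ⟨a, ha', rfl⟩ := (hr x).2 hx
  have hn := c'.four
  rw [Ne, c'.eq_iff ha' (by omega)] at hxy
  rw [c'.adj _ _ (by omega) ha'] at hzx
  have : a = 1 := by omega
  subst this
  refine wheel_case c' hp hk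
    (fun i j hi hj => hd _ ((hr _).1 ⟨i, hi, rfl⟩) j hj) (fun i j hi hi0 hj => ?_) hj hzp
  rw [hadj _ ((hr _).1 ⟨i, hi, rfl⟩) ?_ j hj, c'.eq_iff hi (by omega), c'.eq_iff hi (by omega)]
  rw [Ne, c'.eq_iff hi (by omega)]
  omega

theorem core {V : Type} [Finite V] {G : SimpleGraph V}
    (hth : ¬ HasTheta G) (hpy : ¬ HasPyramid G) (hpr : ¬ HasPrism G) (hw : ¬ HasWheel G)
    {n k : ℕ} {h p : ℕ → V}
    (c : Cyc G n h) (hp : IPath G k p) (hd : ∀ z, InR n h z → ∀ j ≤ k, z ≠ p j)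
    {x y : V} (hx : InR n h x) (hy : InR n h y) (hxy : x ≠ y) (hna : ¬ G.Adj x y)
    (hxp : G.Adj x (p 0)) (hyp : G.Adj y (p k))
    (CC : ∀ z w, InR n h z → InR n h w → ∀ i j, i ≤ k → j ≤ k → G.Adj z (p i) → G.Adj w (p j) →
      z = w ∨ G.Adj z w ∨ (i = 0 ∧ j = k) ∨ (i = k ∧ j = 0)) : False := by
  have xonly : ∀ j ≤ k, G.Adj x (p j) → j = 0 := by
    intro j hj ha
    rcases CC x y hx hy j k hj le_rfl ha hyp with e | e | e | e
    · exact absurd e hxy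
    · exact absurd e hna
    · omega
    · omega
  have yonly : ∀ j ≤ k, G.Adj y (p j) → j = k := by
    intro j hj ha
    rcases CC x y hx hy 0 j (by omega) hj hxp ha with e | e | e | e
    · exact absurd e hxy
    · exact absurd e hna
    · omega
    · omega
  rcases Nat.eq_zero_or_pos k with hk | hk
  · subst hk
    refine hth (core_theta c hp hd hx hy hxy hna ?_)
    intro z hz j hj
    obtain rfl : j = 0 := by omega
    constructor
    · intro ha
      by_contra hcon
      have hzx : z ≠ x := fun e => hcon (Or.inl ⟨e, rfl⟩)
      have hzy : z ≠ y := fun e => hcon (Or.inr ⟨e, rfl⟩)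
      refine hw ⟨{v | InR n h v}, p 0, cyc_hole c _ (fun v => Iff.rfl), ?_, ?_⟩
      · intro hin; exact hd _ hin 0 le_rfl rfl
      · have h3 : ({x, y, z} : Set V).ncard = 3 := by
          rw [Set.ncard_eq_three]
          exact ⟨_, _, _, hxy, hzx.symm, hzy.symm, rfl⟩
        rw [← h3]
        refine Set.ncard_le_ncard ?_ (Set.toFinite _)
        rintro v (rfl | rfl | rfl)
        · exact ⟨hx, hxp.symm⟩
        · exact ⟨hy, hyp.symm⟩
        · exact ⟨hz, ha.symm⟩
    · rintro (⟨rfl, -⟩ | ⟨rfl, -⟩)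
      · exact hxp
      · exact hyp
  -- the set of attachments of `p 0, ..., p (k-1)` is a clique
  have C1 : ∀ z w, InR n h z → InR n h w → ∀ i j, i < k → j < k → G.Adj z (p i) →
      G.Adj w (p j) → z = w ∨ G.Adj z w := by
    intro z w hz hw' i j hi hj h1 h2
    rcases CC z w hz hw' i j (by omega) (by omega) h1 h2 with e | e | e | e
    · exact Or.inl e
    · exact Or.inr e
    · omega
    · omega
  have C2 : ∀ z w, InR n h z → InR n h w → ∀ i j, 0 < i → i ≤ k → 0 < j → j ≤ k → G.Adj z (p i) →
      G.Adj w (p j) → z = w ∨ G.Adj z w := by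
    intro z w hz hw' i j hi hi' hj hj' h1 h2
    rcases CC z w hz hw' i j (by omega) (by omega) h1 h2 with e | e | e | e
    · exact Or.inl e
    · exact Or.inr e
    · omega
    · omega
  by_cases hA : ∃ z i j, InR n h z ∧ i < k ∧ 0 < j ∧ j ≤ k ∧ G.Adj z (p i) ∧ G.Adj z (p j)
  · obtain ⟨z, i, j, hz, hi, hj, hjk, hzi, hzj⟩ := hA
    have hzx' : z ≠ x := by
      rintro rfl
      have := xonly j hjk hzj; omega
    have hzy' : z ≠ y := by
      rintro rfl
      have := yonly i hi.le hzi; omega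
    have hzx : G.Adj z x := (C1 z x hz hx i 0 hi hk hzi hxp).resolve_left hzx'
    have hzy : G.Adj z y := (C2 z y hz hy j k hj hjk hk le_rfl hzj hyp).resolve_left hzy'
    refine hw (core_wheel c hp hk hd hx hy hz hxy hzx hzy ?_ hjk hzj)
    intro w hw' hwz l hl
    constructor
    · intro ha
      by_cases hlk : l < k
      · left
        have hwz2 : G.Adj w z := (C1 w z hw' hz l i hlk hi ha hzi).resolve_left hwz
        rcases C1 w x hw' hx l 0 hlk hk ha hxp with e | e
        · exact ⟨e, xonly l hl (e ▸ ha)⟩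
        · exact (c.no_triangle hw' hz hx hwz2 e hzx).elim
      · obtain rfl : l = k := by omega
        right
        have hwz2 : G.Adj w z :=
          (C2 w z hw' hz l j hk le_rfl hj hjk ha hzj).resolve_left hwz
        rcases C2 w y hw' hy l l hk le_rfl hk le_rfl ha hyp with e | e
        · exact ⟨e, rfl⟩
        · exact (c.no_triangle hw' hz hy hwz2 e hzy).elim
    · rintro (⟨rfl, rfl⟩ | ⟨rfl, rfl⟩)
      · exact hxp
      · exact hyp
  have F0 : ∀ z, InR n h z → ∀ l ≤ k, G.Adj z (p l) → l = 0 ∨ l = k := by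
    intro z hz l hl ha
    by_contra hcon
    exact hA ⟨z, l, l, hz, by omega, by omega, hl, ha, ha⟩
  have D : ∀ z, InR n h z → G.Adj z (p 0) → G.Adj z (p k) → False :=
    fun z hz h1 h2 => hA ⟨z, 0, k, hz, hk, hk, le_rfl, h1, h2⟩
  have Q0 : ∀ z w, InR n h z → InR n h w → G.Adj z (p 0) → G.Adj w (p 0) → z = w ∨ G.Adj z w :=
    fun z w hz hw' h1 h2 => C1 z w hz hw' 0 0 hk hk h1 h2
  have Qk : ∀ z w, InR n h z → InR n h w → G.Adj z (p k) → G.Adj w (p k) → z = w ∨ G.Adj z w :=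
    fun z w hz hw' h1 h2 => C2 z w hz hw' k k hk le_rfl hk le_rfl h1 h2
  have T0 : ∀ x', InR n h x' → x' ≠ x → G.Adj x' (p 0) → ∀ z, InR n h z → G.Adj z (p 0) →
      z = x ∨ z = x' := by
    intro x' hx' hne h1 z hz h2
    by_contra! hcon
    exact c.no_triangle hz hx hx' ((Q0 z x hz hx h2 hxp).resolve_left hcon.1)
      ((Q0 z x' hz hx' h2 h1).resolve_left hcon.2) ((Q0 x x' hx hx' hxp h1).resolve_left hne.symm)
  have Tk : ∀ y', InR n h y' → y' ≠ y → G.Adj y' (p k) → ∀ z, InR n h z → G.Adj z (p k) →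
      z = y ∨ z = y' := by
    intro x' hx' hne h1 z hz h2
    by_contra! hcon
    exact c.no_triangle hz hy hx' ((Qk z y hz hy h2 hyp).resolve_left hcon.1)
      ((Qk z x' hz hx' h2 h1).resolve_left hcon.2) ((Qk y x' hy hx' hyp h1).resolve_left hne.symm)
  by_cases hX : ∃ x', InR n h x' ∧ x' ≠ x ∧ G.Adj x' (p 0)
  · obtain ⟨x', hx', hxne, hx'p⟩ := hX
    by_cases hY : ∃ y', InR n h y' ∧ y' ≠ y ∧ G.Adj y' (p k)
    · obtain ⟨y', hy', hyne, hy'p⟩ := hY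
      refine hpr (core_prism c hp hk hd hx hx' hy hy' hxy ?_ ?_ ?_
        ((Q0 x x' hx hx' hxp hx'p).resolve_left hxne.symm)
        ((Qk y y' hy hy' hyp hy'p).resolve_left hyne.symm) ?_)
      · rintro rfl; exact D _ hx hxp hy'p
      · rintro rfl; exact D _ hx' hx'p hyp
      · rintro rfl; exact D _ hx' hx'p hy'p
      intro z hz j hj
      constructor
      · intro ha
        rcases F0 z hz j hj ha with rfl | rfl
        · rcases T0 x' hx' hxne hx'p z hz ha with e | e <;> simp [e]
        · rcases Tk y' hy' hyne hy'p z hz ha with e | e <;> simp [e]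
      · rintro (⟨rfl, rfl⟩ | ⟨rfl, rfl⟩ | ⟨rfl, rfl⟩ | ⟨rfl, rfl⟩) <;> assumption
    · refine hpy (core_pyramid c hp.rev hk (fun z hz j hj => hd z hz _ (by omega)) hy hx hx'
        hxy.symm ?_ ((Q0 x x' hx hx' hxp hx'p).resolve_left hxne.symm) ?_)
      · rintro rfl; exact D _ hx' hx'p hyp
      intro z hz j hj
      constructor
      · intro ha
        rcases F0 z hz (k - j) (by omega) ha with e0 | e0
        · simp only [e0] at ha
          have : j = k := by omega
          rcases T0 x' hx' hxne hx'p z hz ha with e | e <;> simp [e, this]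
        · simp only [e0] at ha
          have : j = 0 := by omega
          left
          refine ⟨?_, this⟩
          by_contra hne
          exact hY ⟨z, hz, hne, ha⟩
      · rintro (⟨rfl, rfl⟩ | ⟨rfl, rfl⟩ | ⟨rfl, rfl⟩) <;> simpa
  · by_cases hY : ∃ y', InR n h y' ∧ y' ≠ y ∧ G.Adj y' (p k)
    · obtain ⟨y', hy', hyne, hy'p⟩ := hY
      refine hpy (core_pyramid c hp hk hd hx hy hy' hxy ?_
        ((Qk y y' hy hy' hyp hy'p).resolve_left hyne.symm) ?_)
      · rintro rfl; exact D _ hx hxp hy'p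
      intro z hz j hj
      constructor
      · intro ha
        rcases F0 z hz j hj ha with rfl | rfl
        · left
          refine ⟨?_, rfl⟩
          by_contra hne
          exact hX ⟨z, hz, hne, ha⟩
        · rcases Tk y' hy' hyne hy'p z hz ha with e | e <;> simp [e]
      · rintro (⟨rfl, rfl⟩ | ⟨rfl, rfl⟩ | ⟨rfl, rfl⟩) <;> assumption
    · refine hth (core_theta c hp hd hx hy hxy hna ?_)
      intro z hz j hj
      constructor
      · intro ha
        rcases F0 z hz j hj ha with rfl | rfl
        · left
          refine ⟨?_, rfl⟩
          by_contra hne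
          exact hX ⟨z, hz, hne, ha⟩
        · right
          refine ⟨?_, rfl⟩
          by_contra hne
          exact hY ⟨z, hz, hne, ha⟩
      · rintro (⟨rfl, rfl⟩ | ⟨rfl, rfl⟩) <;> assumption

/-- `c` lies in the component of `u` in `G - S`. -/
def Comp {V : Type} (G : SimpleGraph V) (S : Set V) (u c : V) : Prop :=
  ∃ (h : u ∈ Sᶜ) (h' : c ∈ Sᶜ), (G.induce Sᶜ).Reachable ⟨u, h⟩ ⟨c, h'⟩

theorem reach_induct {V : Type} {G : SimpleGraph V} {T : Set V} {P : V → Prop} {a b : T}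
    (hr : (G.induce T).Reachable a b) (h0 : P a)
    (hs : ∀ c d, c ∈ T → d ∈ T → G.Adj c d → P c → P d) : P b := by
  obtain ⟨w⟩ := hr
  induction w with
  | nil => exact h0
  | cons ha w ih => exact ih (hs _ _ (Subtype.prop _) (Subtype.prop _) ha h0)

theorem walk_sub {W : Type} {F : SimpleGraph W} {a b : W} (w : F.Walk a b) (d i : ℕ)
    (h : i + d ≤ w.length) :
    ∃ q : F.Walk (w.getVert i) (w.getVert (i + d)), q.length = d := by
  induction d with
  | zero => exact ⟨.nil, rfl⟩
  | succ d ih =>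
    obtain ⟨q, hq⟩ := ih (by omega)
    have ha : F.Adj (w.getVert (i + d)) (w.getVert (i + (d + 1))) :=
      w.adj_getVert_succ (by omega)
    exact ⟨q.concat ha, by simp [hq]⟩

theorem walk_sub' {W : Type} {F : SimpleGraph W} {a b : W} (w : F.Walk a b) (i j : ℕ)
    (hij : i ≤ j) (h : j ≤ w.length) :
    ∃ q : F.Walk (w.getVert i) (w.getVert j), q.length = j - i := by
  obtain ⟨d, rfl⟩ := Nat.exists_eq_add_of_le hij
  obtain ⟨q, hq⟩ := walk_sub w d i h
  exact ⟨q, by omega⟩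

theorem geodesic_lower {W : Type} {F : SimpleGraph W} {a b : W} (w : F.Walk a b)
    (hw : w.length = F.dist a b) (i j : ℕ) (hij : i ≤ j) (hj : j ≤ w.length)
    (q : F.Walk (w.getVert i) (w.getVert j)) : j - i ≤ q.length := by
  have := F.dist_le ((w.take i).append (q.append (w.drop j)))
  simp only [Walk.length_append, Walk.take_length, Walk.drop_length] at this
  omega

theorem attach {V : Type} {G : SimpleGraph V} (hc : ¬ HasCliqueCutset G) (S : Set V) (u : V)
    (hu : u ∉ S) (hS : ∀ K ⊆ S, G.IsClique K → ∃ s, s ∉ K ∧ ¬ Comp G S u s) :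
    ∃ k p x y, IPath G k p ∧ (∀ j ≤ k, Comp G S u (p j)) ∧ x ∈ S ∧ y ∈ S ∧ x ≠ y ∧ ¬ G.Adj x y ∧
      G.Adj x (p 0) ∧ G.Adj y (p k) ∧
      ∀ z w, z ∈ S → w ∈ S → ∀ i j, i ≤ k → j ≤ k → G.Adj z (p i) → G.Adj w (p j) →
        z = w ∨ G.Adj z w ∨ (i = 0 ∧ j = k) ∨ (i = k ∧ j = 0) := by
  have hB : ∃ x y c d, x ∈ S ∧ y ∈ S ∧ x ≠ y ∧ ¬ G.Adj x y ∧ Comp G S u c ∧ Comp G S u d ∧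
      G.Adj x c ∧ G.Adj y d := by
    by_contra hcon
    let K : Set V := {x | x ∈ S ∧ ∃ c, Comp G S u c ∧ G.Adj x c}
    have hK : G.IsClique K := by
      rintro x ⟨hx, c, hcc, hxc⟩ y ⟨hy, d, hdd, hyd⟩ hne
      by_contra hna
      exact hcon ⟨x, y, c, d, hx, hy, hne, hna, hcc, hdd, hxc, hyd⟩
    obtain ⟨s, hsK, hsC⟩ := hS K (fun x hx => hx.1) hK
    have hpre : (G.induce Kᶜ).Preconnected := by
      by_contra hp
      exact hc ⟨K, hK, hp⟩
    have hr := hpre ⟨u, fun h => hu h.1⟩ ⟨s, hsK⟩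
    refine hsC (reach_induct (P := Comp G S u) hr ⟨hu, hu, Reachable.refl _⟩ ?_)
    intro a b ha hb hab hca
    have hbS : b ∉ S := fun h => hb ⟨h, a, hca, hab.symm⟩
    obtain ⟨h1, h2, h3⟩ := hca
    refine ⟨h1, hbS, h3.trans (Adj.reachable ?_)⟩
    exact hab
  let F := G.induce Sᶜ
  let Q : ℕ → Prop := fun k => ∃ c d : (Sᶜ : Set V), F.Reachable ⟨u, hu⟩ c ∧ F.Reachable ⟨u, hu⟩ d ∧
    F.dist c d = k ∧ ∃ x y, x ∈ S ∧ y ∈ S ∧ x ≠ y ∧ ¬ G.Adj x y ∧ G.Adj x c ∧ G.Adj y d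
  have hQ : ∃ k, Q k := by
    obtain ⟨x, y, c, d, hx, hy, hne, hna, ⟨_, h2, h3⟩, ⟨_, h5, h6⟩, hxc, hyd⟩ := hB
    exact ⟨_, ⟨c, h2⟩, ⟨d, h5⟩, h3, h6, rfl, x, y, hx, hy, hne, hna, hxc, hyd⟩
  classical
  obtain ⟨c, d, hcr, hdr, hdist, x, y, hx, hy, hne, hna, hxc, hyd⟩ := Nat.find_spec hQ
  have hmin : ∀ m, Q m → Nat.find hQ ≤ m := fun m hm => Nat.find_min' hQ hm
  obtain ⟨w, hw⟩ := (hcr.symm.trans hdr).exists_walk_length_eq_dist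
  set k := Nat.find hQ with hkdef
  have hwk : w.length = k := by rw [hw, hdist]
  have hreach : ∀ j ≤ k, F.Reachable ⟨u, hu⟩ (w.getVert j) := fun j hj =>
    hcr.trans ⟨w.take j⟩
  have hlow : ∀ i j, i ≤ j → j ≤ k → ∀ q : F.Walk (w.getVert i) (w.getVert j), j - i ≤ q.length :=
    fun i j hij hj q => geodesic_lower w hw i j hij (by omega) q
  have hsucc : ∀ i, i < k → F.Adj (w.getVert i) (w.getVert (i + 1)) :=
    fun i hi => w.adj_getVert_succ (by omega)
  have hnadj : ∀ i j, i ≤ j → j ≤ k → F.Adj (w.getVert i) (w.getVert j) → j = i + 1 := by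
    intro i j hij hj ha
    have h1 := hlow i j hij hj ha.toWalk
    have h2 : i ≠ j := by rintro rfl; exact F.loopless.irrefl _ ha
    simp at h1
    omega
  have hneq : ∀ i j, i ≤ j → j ≤ k → w.getVert i = w.getVert j → i = j := by
    intro i j hij hj e
    have h1 := hlow i j hij hj (Walk.nil.copy rfl e)
    simp at h1
    omega
  have hCC : ∀ z v, z ∈ S → v ∈ S → z ≠ v → ¬ G.Adj z v → ∀ i j, i ≤ j → j ≤ k →
      G.Adj z (w.getVert i) → G.Adj v (w.getVert j) → i = 0 ∧ j = k := by
    intro z v hz hv hzv hzva i j hij hj h1 h2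
    have h3 := hmin _ ⟨w.getVert i, w.getVert j, hreach i (by omega), hreach j hj, rfl,
      z, v, hz, hv, hzv, hzva, h1, h2⟩
    obtain ⟨q, hq⟩ := walk_sub' w i j hij (by omega)
    have h4 := F.dist_le q
    omega
  refine ⟨k, fun j => (w.getVert j : V), x, y, ⟨?_, ?_⟩, ?_, hx, hy, hne, hna, ?_, ?_, ?_⟩
  · intro i j hi hj e
    have e' : w.getVert i = w.getVert j := Subtype.ext e
    rcases le_total i j with h | h
    · exact hneq i j h hj e'
    · exact (hneq j i h hi e'.symm).symm
  · intro i j hi hj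
    constructor
    · intro ha
      have ha' : F.Adj (w.getVert i) (w.getVert j) := ha
      rcases le_total i j with h | h
      · exact Or.inl (hnadj i j h hj ha')
      · exact Or.inr (hnadj j i h hi ha'.symm)
    · rintro (rfl | rfl)
      · exact hsucc i (by omega)
      · exact (hsucc j (by omega)).symm
  · intro j hj
    exact ⟨hu, (w.getVert j).2, hreach j hj⟩
  · simpa using hxc
  · have : w.getVert k = d := by rw [← hwk]; exact w.getVert_length
    simpa [this] using hyd
  · intro z v hz hv i j hi hj h1 h2
    by_cases e1 : z = v
    · exact Or.inl e1
    by_cases e2 : G.Adj z v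
    · exact Or.inr (Or.inl e2)
    rcases le_total i j with h | h
    · exact Or.inr (Or.inr (Or.inl (hCC z v hz hv e1 e2 i j h hj h1 h2)))
    · have := hCC v z hv hz (Ne.symm e1) (fun h => e2 h.symm) j i h hi h2 h1
      exact Or.inr (Or.inr (Or.inr ⟨this.2, this.1⟩))

theorem exists_cyc {V : Type} {G : SimpleGraph V} (hc : ¬ HasCliqueCutset G) {u v : V}
    (huv : u ≠ v) (hna : ¬ G.Adj u v) : ∃ n h, Cyc G n h := by
  have hCv : ∀ c, Comp G (G.neighborSet v) u c → c ≠ v := by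
    rintro c ⟨h1, h2, h3⟩
    refine reach_induct (P := fun c => c ≠ v) h3 huv ?_
    rintro a b ha hb hab - rfl
    exact ha hab.symm
  obtain ⟨k, p, x, y, hp, hcomp, hx, hy, hxy, hxya, hxp, hyp, CC⟩ :=
    attach hc (G.neighborSet v) u (fun h => hna h.symm)
      (fun K hK _ => ⟨v, fun h => G.loopless.irrefl _ (hK h), fun h => hCv v h rfl⟩)
  have hpS : ∀ j ≤ k, ¬ G.Adj v (p j) := fun j hj => (hcomp j hj).2.1
  have hvx : G.Adj v x := hx
  have hvy : G.Adj v y := hy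
  have xonly : ∀ j ≤ k, G.Adj x (p j) → j = 0 := by
    intro j hj ha
    rcases CC x y hx hy j k hj le_rfl ha hyp with e | e | e | e
    · exact absurd e hxy
    · exact absurd e hxya
    · omega
    · omega
  have yonly : ∀ j ≤ k, G.Adj y (p j) → j = k := by
    intro j hj ha
    rcases CC x y hx hy 0 j (by omega) hj hxp ha with e | e | e | e
    · exact absurd e hxy
    · exact absurd e hxya
    · omega
    · omega
  let a : ℕ → V := fun i => if i = 0 then x else if i = 1 then v else y
  have a0 : a 0 = x := rfl
  have a1 : a 1 = v := rfl
  have a2 : a 2 = y := rfl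
  have ha : IPath G 2 a := by
    constructor
    · intro i j hi hj
      interval_cases i <;> interval_cases j <;>
        simp [a0, a1, a2, hxy, hxy.symm, hvx.ne, hvx.ne', hvy.ne, hvy.ne']
    · intro i j hi hj
      interval_cases i <;> interval_cases j <;>
        simp [a0, a1, a2, hxya, hvx, hvy, hvx.symm, hvy.symm, G.adj_comm y x]
  obtain ⟨n, h, c, -⟩ := glue (m := 2) ha hp (by omega) (by omega) (fun i j hi hj => by
    interval_cases i
    · rw [a0]; rintro rfl; exact hpS j hj hvx
    · rw [a1]; exact (hCv _ (hcomp j hj)).symm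
    · rw [a2]; rintro rfl; exact hpS j hj hvy) (fun i j hi hj => by
    interval_cases i
    · rw [a0]; exact ⟨fun h => Or.inl ⟨rfl, xonly j hj h⟩, by
        rintro (⟨-, rfl⟩ | ⟨h, -⟩)
        · exact hxp
        · omega⟩
    · rw [a1]; exact ⟨fun h => (hpS j hj h).elim, by omega⟩
    · rw [a2]; exact ⟨fun h => Or.inr ⟨rfl, yonly j hj h⟩, by
        rintro (⟨h, -⟩ | ⟨-, rfl⟩)
        · omega
        · exact hyp⟩)
  exact ⟨n, h, c⟩

theorem statement8 {V : Type} [Fintype V] (G : SimpleGraph V)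
    (hth : ¬ HasTheta G) (hpy : ¬ HasPyramid G) (hpr : ¬ HasPrism G)
    (hw : ¬ HasWheel G) :
    HasCliqueCutset G ∨ (∀ u v : V, u ≠ v → G.Adj u v) ∨
      ∃ n : ℕ, 4 ≤ n ∧ Nonempty (G ≃g cycleGraph n) := by
  by_contra hcon
  push Not at hcon
  obtain ⟨hc, ⟨u, v, huv, hna⟩, hiso⟩ := hcon
  obtain ⟨n, h, c⟩ := exists_cyc hc huv hna
  have h4 := c.four
  by_cases hall : ∀ v, InR n h v
  · obtain ⟨m, hm, ⟨e⟩⟩ := cyc_hole c Set.univ (fun v => ⟨fun _ => hall v, fun _ => trivial⟩)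
    exact (hiso m hm).false ((induceUnivIso G).symm.trans e)
  push Not at hall
  obtain ⟨t, ht⟩ := hall
  obtain ⟨k, p, x, y, hp, hcomp, hx, hy, hxy, hxya, hxp, hyp, CC⟩ :=
    attach hc {v | InR n h v} t ht (by
      intro K hK hcl
      have h0 : ∀ i < n, ¬ Comp G {v | InR n h v} t (h i) := fun i hi hco =>
        hco.2.1 ⟨i, hi, rfl⟩
      by_cases hk0 : h 0 ∈ K
      · refine ⟨h 2, fun hk2 => ?_, h0 2 (by omega)⟩
        have := hcl hk0 hk2 (fun e => by
          have := c.inj _ _ (by omega) (by omega) e; omega)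
        rw [c.adj _ _ (by omega) (by omega)] at this
        omega
      · exact ⟨h 0, hk0, h0 0 (by omega)⟩)
  refine core hth hpy hpr hw c hp (fun z hz j hj e => ?_) hx hy hxy hxya hxp hyp CC
  exact (hcomp j hj).2.1 (e ▸ hz)

end Paper
end

section
/- Every finite simple (theta, pyramid, prism, wheel)-free graph G satisfies tw(G) ≤ max{ω(G)−1, 2} and tc(G) ≤ 2; in particular, every (theta, wheel, K3)-free graph has treewidth at most 2. Here tw is the treewidth, tc the tree clique cover number, and ω the clique number. -/
open SimpleGraph

namespace Paper

variable {V : Type*}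

/-! ### Tree decompositions on vertex subsets, and gluing -/

lemma reach_map {W : Type*} {G : SimpleGraph V} {H : SimpleGraph W} (f : V → W)
    (h : ∀ u v, G.Adj u v → H.Reachable (f u) (f v)) {u v : V} (r : G.Reachable u v) :
    H.Reachable (f u) (f v) := by
  obtain ⟨w⟩ := r
  induction w with
  | nil => exact Reachable.refl _
  | cons hadj _ ih => exact (h _ _ hadj).trans ih

lemma induce_image_connected {W : Type*} {G : SimpleGraph V} {H : SimpleGraph W} (f : V → W)
    (hf : ∀ u v, G.Adj u v → H.Adj (f u) (f v)) {s : Set V} (hs : (G.induce s).Connected) :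
    (H.induce (f '' s)).Connected := by
  let F : G.induce s →g H.induce (f '' s) :=
    { toFun := fun x => ⟨f x, x, x.2, rfl⟩
      map_rel' := by
        intro a b hab
        exact hf _ _ hab }
  refine hs.map F ?_
  rintro ⟨_, x, hx, rfl⟩
  exact ⟨⟨x, hx⟩, rfl⟩

lemma sum_not_reachable {α β : Type*} (T₁ : SimpleGraph α) (T₂ : SimpleGraph β) (a : α) (b : β) :
    ¬ (T₁ ⊕g T₂).Reachable (Sum.inl a) (Sum.inr b) := by
  intro h
  have := reach_map (H := (⊥ : SimpleGraph Bool)) (fun x => x.isLeft) (by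
    rintro (u | u) (v | v) huv <;> simp at huv ⊢) h
  simp at this

lemma sum_acyclic {α β : Type*} {T₁ : SimpleGraph α} {T₂ : SimpleGraph β} (h₁ : T₁.IsAcyclic)
    (h₂ : T₂.IsAcyclic) : (T₁ ⊕g T₂).IsAcyclic := by
  rw [isAcyclic_iff_forall_adj_isBridge] at *
  rintro (u | u) (v | v) huv
  · have hb := h₁ (show T₁.Adj u v by simpa using huv)
    rw [isBridge_iff] at hb ⊢
    intro hr
    apply hb
    refine reach_map (fun x : α ⊕ β => x.elim id (fun _ => u)) ?_ hr
    rintro (a | a) (b | b) hab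
    · apply Adj.reachable
      simp [deleteEdges_adj] at hab ⊢
      exact hab
    · simp at hab
    · simp at hab
    · exact Reachable.refl _
  · simp at huv
  · simp at huv
  · have hb := h₂ (show T₂.Adj u v by simpa using huv)
    rw [isBridge_iff] at hb ⊢
    intro hr
    apply hb
    refine reach_map (fun x : α ⊕ β => x.elim (fun _ => u) id) ?_ hr
    rintro (a | a) (b | b) hab
    · exact Reachable.refl _
    · simp at hab
    · simp at hab
    · apply Adj.reachable
      simp [deleteEdges_adj] at hab ⊢
      exact hab

/-- A tree decomposition of `F[S]` all of whose bags are good, such that every clique of `F[S]`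
is in a bag. -/
def Dec (F : SimpleGraph V) (Good : Set V → Prop) (S : Set V) : Prop :=
  ∃ (ι : Type) (T : SimpleGraph ι) (bag : ι → Set V), T.IsAcyclic ∧ T.Connected ∧
    (∀ t, bag t ⊆ S ∧ Good (bag t)) ∧ (∀ K ⊆ S, F.IsClique K → ∃ t, K ⊆ bag t) ∧
    ∀ v ∈ S, (T.induce {t | v ∈ bag t}).Connected

lemma Dec.base {F : SimpleGraph V} {Good : Set V → Prop} {S : Set V} (h : Good S) :
    Dec F Good S := by
  refine ⟨Unit, ⊥, fun _ => S, IsAcyclic.of_subsingleton, ?_, fun _ => ⟨subset_rfl, h⟩,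
    fun K hK _ => ⟨(), hK⟩, ?_⟩
  · exact (IsTree.of_subsingleton (G := (⊥ : SimpleGraph Unit))).connected
  · intro v hv
    have : Nonempty {t : Unit | v ∈ S} := ⟨⟨(), hv⟩⟩
    exact (IsTree.of_subsingleton).connected

lemma Dec.mono {F G : SimpleGraph V} {Good : Set V → Prop} {S : Set V} (hle : G ≤ F)
    (h : Dec F Good S) : Dec G Good S := by
  obtain ⟨ι, T, bag, h1, h2, h3, h4, h5⟩ := h
  exact ⟨ι, T, bag, h1, h2, h3, fun K hK hc => h4 K hK (hc.mono hle), h5⟩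

lemma Dec.glue {F : SimpleGraph V} {Good : Set V → Prop} {A B : Set V} (hA : Dec F Good A)
    (hB : Dec F Good B) (hc : F.IsClique (A ∩ B))
    (hn : ∀ a ∈ A, a ∉ B → ∀ b ∈ B, b ∉ A → ¬ F.Adj a b) : Dec F Good (A ∪ B) := by
  obtain ⟨ι₁, T₁, bag₁, ac₁, co₁, g₁, cl₁, st₁⟩ := hA
  obtain ⟨ι₂, T₂, bag₂, ac₂, co₂, g₂, cl₂, st₂⟩ := hB
  obtain ⟨t₁, ht₁⟩ := cl₁ _ Set.inter_subset_left hc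
  obtain ⟨t₂, ht₂⟩ := cl₂ _ Set.inter_subset_right hc
  have hl : ∀ u v, T₁.Adj u v → ((T₁ ⊕g T₂) ⊔ edge (Sum.inl t₁) (Sum.inr t₂)).Adj
      (Sum.inl u) (Sum.inl v) := by
    intro u v h; left; simpa using h
  have hr : ∀ u v, T₂.Adj u v → ((T₁ ⊕g T₂) ⊔ edge (Sum.inl t₁) (Sum.inr t₂)).Adj
      (Sum.inr u) (Sum.inr v) := by
    intro u v h; left; simpa using h
  have he : ((T₁ ⊕g T₂) ⊔ edge (Sum.inl t₁) (Sum.inr t₂)).Adj (Sum.inl t₁) (Sum.inr t₂) := by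
    right; simp [edge_adj]
  refine ⟨ι₁ ⊕ ι₂, (T₁ ⊕g T₂) ⊔ edge (Sum.inl t₁) (Sum.inr t₂), Sum.elim bag₁ bag₂,
    (sum_acyclic ac₁ ac₂).sup_edge_of_not_reachable (sum_not_reachable _ _ _ _), ?_, ?_, ?_, ?_⟩
  · rw [connected_iff_exists_forall_reachable]
    refine ⟨Sum.inl t₁, ?_⟩
    rintro (t | t)
    · exact reach_map _ (fun u v h => (hl u v h).reachable) (co₁.preconnected t₁ t)
    · exact he.reachable.trans
        (reach_map _ (fun u v h => (hr u v h).reachable) (co₂.preconnected t₂ t))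
  · rintro (t | t)
    · exact ⟨(g₁ t).1.trans Set.subset_union_left, (g₁ t).2⟩
    · exact ⟨(g₂ t).1.trans Set.subset_union_right, (g₂ t).2⟩
  · intro K hK hcl
    by_cases h : K ⊆ A
    · obtain ⟨t, ht⟩ := cl₁ K h hcl
      exact ⟨Sum.inl t, ht⟩
    · have : K ⊆ B := by
        by_contra hB
        obtain ⟨b, hb, hbA⟩ := Set.not_subset.1 h
        obtain ⟨a, ha, haB⟩ := Set.not_subset.1 hB
        have haA : a ∈ A := (hK ha).resolve_right haB
        have hbB : b ∈ B := (hK hb).resolve_left hbA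
        refine hn a haA haB b hbB hbA (hcl ha hb ?_)
        rintro rfl; exact hbA haA
      obtain ⟨t, ht⟩ := cl₂ K this hcl
      exact ⟨Sum.inr t, ht⟩
  · intro v hv
    have hset : {t : ι₁ ⊕ ι₂ | v ∈ Sum.elim bag₁ bag₂ t} =
        Sum.inl '' {t | v ∈ bag₁ t} ∪ Sum.inr '' {t | v ∈ bag₂ t} := by
      ext (t | t) <;> simp
    rw [hset]
    by_cases hvA : v ∈ A
    · by_cases hvB : v ∈ B
      · exact connected_induce_union
          (induce_image_connected _ hl (st₁ v hvA)).preconnected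
          (induce_image_connected _ hr (st₂ v hvB)).preconnected
          ⟨t₁, ht₁ ⟨hvA, hvB⟩, rfl⟩ ⟨t₂, ht₂ ⟨hvA, hvB⟩, rfl⟩ he
      · have : {t | v ∈ bag₂ t} = ∅ := by
          ext t; simpa using fun h => hvB ((g₂ t).1 h)
        rw [this, Set.image_empty, Set.union_empty]
        exact induce_image_connected _ hl (st₁ v hvA)
    · have hvB : v ∈ B := hv.resolve_left hvA
      have : {t | v ∈ bag₁ t} = ∅ := by
        ext t; simpa using fun h => hvA ((g₁ t).1 h)
      rw [this, Set.image_empty, Set.empty_union]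
      exact induce_image_connected _ hr (st₂ v hvB)

/-- The bags we allow. -/
def GoodBag (G : SimpleGraph V) (B : Set V) : Prop :=
  G.IsClique B ∨ ∃ x y z, G.Adj x y ∧ B = {x, y, z}

lemma GoodBag.card {V : Type} [Fintype V] {G : SimpleGraph V} {B : Set V} (h : GoodBag G B) :
    B.ncard ≤ max (cliqueNum G - 1) 2 + 1 := by
  rcases h with h | ⟨x, y, z, -, rfl⟩
  · have : B.ncard ≤ cliqueNum G := by
      apply le_csSup
      · refine ⟨Fintype.card V, ?_⟩
        rintro n ⟨S, -, rfl⟩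
        rw [← Nat.card_eq_fintype_card]
        exact Set.ncard_le_card S
      · exact ⟨B, h, rfl⟩
    omega
  · have : ({x, y, z} : Set V).ncard ≤ 3 := by
      have h1 := Set.ncard_insert_le x ({y, z} : Set V)
      have h2 := Set.ncard_insert_le y ({z} : Set V)
      have h3 := Set.ncard_singleton z
      omega
    omega

lemma cover_le_two {W : Type*} {G : SimpleGraph W} (C : Set W) (h : G.IsClique C)
    (h' : G.IsClique Cᶜ) : cliqueCoverNum G ≤ 2 := by
  classical
  have hm : ({C, Cᶜ} : Finset (Set W)).card ≤ 2 := Finset.card_le_two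
  refine le_trans ?_ hm
  apply Nat.sInf_le
  refine ⟨{C, Cᶜ}, rfl, ?_, ?_⟩
  · intro D hD
    simp only [Finset.mem_insert, Finset.mem_singleton] at hD
    rcases hD with rfl | rfl <;> assumption
  · intro v
    by_cases hv : v ∈ C
    · refine ⟨C, by simp [hv], ?_⟩
      rintro D ⟨hD, hvD⟩
      simp only [Finset.mem_insert, Finset.mem_singleton] at hD
      rcases hD with rfl | rfl
      · rfl
      · exact absurd hv hvD
    · refine ⟨Cᶜ, by simp [hv], ?_⟩
      rintro D ⟨hD, hvD⟩
      simp only [Finset.mem_insert, Finset.mem_singleton] at hD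
      rcases hD with rfl | rfl
      · exact absurd hvD hv
      · rfl

lemma GoodBag.cover {G : SimpleGraph V} {B : Set V} (h : GoodBag G B) :
    cliqueCoverNum (G.induce B) ≤ 2 := by
  rcases h with h | ⟨x, y, z, hxy, rfl⟩
  · apply cover_le_two Set.univ
    · rintro ⟨a, ha⟩ - ⟨b, hb⟩ - hab
      exact h ha hb (fun e => hab (Subtype.ext e))
    · simp
  · apply cover_le_two {w | w.1 = x ∨ w.1 = y}
    · rintro ⟨a, ha⟩ ha' ⟨b, hb⟩ hb' hab
      simp only [Set.mem_ofPred_eq, ne_eq, Subtype.mk.injEq, comap_adj,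
        Function.Embedding.subtype_apply] at *
      rcases ha' with rfl | rfl <;> rcases hb' with rfl | rfl <;>
        first | exact absurd rfl hab | exact hxy | exact hxy.symm
    · rintro ⟨a, ha⟩ ha' ⟨b, hb⟩ hb' hab
      exfalso
      simp only [Set.mem_compl_iff, Set.mem_ofPred_eq, Set.mem_insert_iff,
        Set.mem_singleton_iff] at ha ha' hb hb'
      apply hab
      have : a = z := by tauto
      have : b = z := by tauto
      simp_all

lemma Dec.final {V : Type} [Fintype V] {G : SimpleGraph V} (h : Dec G (GoodBag G) Set.univ) :
    treewidth G ≤ max (cliqueNum G - 1) 2 ∧ treeCliqueCoverNum G ≤ 2 := by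
  obtain ⟨ι, T, bag, ac, co, g, cl, st⟩ := h
  let D : TreeDecomp G :=
    { ι := ι, tree := T, tree_acyclic := ac, tree_connected := co, bag := bag
      bag_cover := by
        intro v
        obtain ⟨t, ht⟩ := cl {v} (Set.subset_univ _) (by simp)
        exact ⟨t, ht rfl⟩
      bag_edge := by
        intro u v huv
        obtain ⟨t, ht⟩ := cl {u, v} (Set.subset_univ _) (by
          rw [isClique_pair]; exact fun _ => huv)
        exact ⟨t, ht (by simp), ht (by simp)⟩
      bag_subtree := fun v => st v trivial }
  exact ⟨Nat.sInf_le ⟨D, fun t => (g t).2.card⟩, Nat.sInf_le ⟨D, fun t => (g t).2.cover⟩⟩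


/-! ### Holes, induced paths and the three-path configurations -/

/-- `p` is a periodic enumeration of a hole of length `n`. -/
def Cyc_s9 (G : SimpleGraph V) (p : ℕ → V) (n : ℕ) : Prop :=
  4 ≤ n ∧ (∀ i, p (i + n) = p i) ∧
    ∀ i d, 0 < d → d < n → p i ≠ p (i + d) ∧ (G.Adj (p i) (p (i + d)) ↔ d = 1 ∨ d = n - 1)

/-- `p 0, …, p t` is an induced path. -/
def IndPath (G : SimpleGraph V) (p : ℕ → V) (t : ℕ) : Prop :=
  ∀ i j, i ≤ t → j ≤ t → i < j → p i ≠ p j ∧ (G.Adj (p i) (p j) ↔ j = i + 1)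

/-- The vertices `p a, …, p b`. -/
def pts (p : ℕ → V) (a b : ℕ) : Set V := {v | ∃ i, a ≤ i ∧ i ≤ b ∧ p i = v}

lemma mem_pts {p : ℕ → V} {a b i : ℕ} (h : a ≤ i) (h' : i ≤ b) : p i ∈ pts p a b := ⟨i, h, h', rfl⟩

lemma cyc_of_hole {G : SimpleGraph V} {S : Set V} (h : IsHoleSet G S) :
    ∃ p n, Cyc_s9 G p n ∧ S = pts p 0 (n - 1) := by
  obtain ⟨n, hn, ⟨e⟩⟩ := h
  have hpos : 0 < n := by omega
  refine ⟨fun i => (e.symm ⟨i % n, Nat.mod_lt _ hpos⟩).1, n, ⟨hn, ?_, ?_⟩, ?_⟩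
  · intro i
    simp
  · intro i d hd hdn
    have hr : i % n < n := Nat.mod_lt _ hpos
    have hs : (i + d) % n = i % n + d ∧ i % n + d < n ∨
        (i + d) % n + n = i % n + d ∧ n ≤ i % n + d := by
      rw [Nat.add_mod, Nat.mod_eq_of_lt hdn]
      by_cases h : i % n + d < n
      · left; exact ⟨Nat.mod_eq_of_lt h, h⟩
      · right
        rw [Nat.mod_eq_sub_mod (by omega), Nat.mod_eq_of_lt (by omega)]
        omega
    have hs' : (i + d) % n < n := Nat.mod_lt _ hpos
    constructor
    · intro heq
      have := e.symm.injective (Subtype.ext heq)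
      rw [Fin.mk.injEq] at this
      omega
    · have h1 : G.Adj (e.symm ⟨i % n, hr⟩).1 (e.symm ⟨(i + d) % n, hs'⟩).1 ↔
          (cycleGraph n).Adj ⟨i % n, hr⟩ ⟨(i + d) % n, hs'⟩ := by
        rw [← e.symm.map_adj_iff]; rfl
      rw [h1, cycleGraph_adj']
      simp only [Fin.sub_def]
      generalize (i + d) % n = b at *
      generalize i % n = a at *
      have key : ∀ x, x < 2 * n → (x % n = 1 ↔ x = 1 ∨ x = n + 1) := by
        intro x hx
        by_cases hxn : x < n
        · rw [Nat.mod_eq_of_lt hxn]; omega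
        · rw [Nat.mod_eq_sub_mod (by omega), Nat.mod_eq_of_lt (by omega)]; omega
      rw [key _ (by omega), key _ (by omega)]
      omega
  · ext v
    constructor
    · intro hv
      refine ⟨e ⟨v, hv⟩, by omega, by have := (e ⟨v, hv⟩).2; omega, ?_⟩
      have : (⟨(e ⟨v, hv⟩ : ℕ) % n, Nat.mod_lt _ hpos⟩ : Fin n) = e ⟨v, hv⟩ := by
        ext; exact Nat.mod_eq_of_lt (e ⟨v, hv⟩).2
      simp [this]
    · rintro ⟨i, -, -, rfl⟩
      exact (e.symm _).2

lemma hole_of_enum {G : SimpleGraph V} {c : ℕ → V} {n : ℕ} (hn : 4 ≤ n)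
    (h : ∀ i j, i < j → j < n → c i ≠ c j ∧ (G.Adj (c i) (c j) ↔ j = i + 1 ∨ (i = 0 ∧ j = n - 1))) :
    IsHoleSet G (pts c 0 (n - 1)) := by
  refine ⟨n, hn, ⟨RelIso.symm ?_⟩⟩
  let f : Fin n → pts c 0 (n - 1) := fun i => ⟨c i, i, by omega, by omega, rfl⟩
  have hf : Function.Bijective f := by
    constructor
    · intro a b hab
      have hab' : c a = c b := congrArg Subtype.val hab
      rcases lt_trichotomy a.1 b.1 with hl | hl | hl
      · exact absurd hab' (h _ _ hl b.2).1
      · exact Fin.ext hl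
      · exact absurd hab'.symm (h _ _ hl a.2).1
    · rintro ⟨_, i, -, hi, rfl⟩
      exact ⟨⟨i, by omega⟩, rfl⟩
  have hlt : ∀ a b : Fin n, a.1 < b.1 → (G.Adj (c a) (c b) ↔ (cycleGraph n).Adj a b) := by
    intro a b hab
    rw [(h _ _ hab b.2).2, cycleGraph_adj']
    simp only [Fin.sub_def]
    have key : ∀ x, x < 2 * n → (x % n = 1 ↔ x = 1 ∨ x = n + 1) := by
      intro x hx
      by_cases hxn : x < n
      · rw [Nat.mod_eq_of_lt hxn]; omega
      · rw [Nat.mod_eq_sub_mod (by omega), Nat.mod_eq_of_lt (by omega)]; omega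
    rw [key _ (by omega), key _ (by omega)]
    omega
  refine ⟨Equiv.ofBijective f hf, ?_⟩
  intro a b
  change G.Adj (c a) (c b) ↔ _
  rcases lt_trichotomy a.1 b.1 with hl | hl | hl
  · exact hlt a b hl
  · have : a = b := Fin.ext hl
    subst this
    simp
  · rw [G.adj_comm, (cycleGraph n).adj_comm]
    exact hlt b a hl

lemma IndPath.rev {G : SimpleGraph V} {p : ℕ → V} {t : ℕ} (h : IndPath G p t) :
    IndPath G (fun i => p (t - i)) t := by
  intro i j hi hj hij
  have := h (t - j) (t - i) (by omega) (by omega) (by omega)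
  refine ⟨this.1.symm, ?_⟩
  rw [G.adj_comm, this.2]
  omega

lemma pts_rev (p : ℕ → V) (t : ℕ) : pts (fun i => p (t - i)) 0 t = pts p 0 t := by
  ext v
  constructor
  · rintro ⟨i, -, hi, rfl⟩; exact ⟨t - i, by omega, by omega, rfl⟩
  · rintro ⟨i, -, hi, rfl⟩
    exact ⟨t - i, by omega, by omega, by simp only; congr 1; omega⟩

lemma hole_of_two {G : SimpleGraph V} {p q : ℕ → V} {t k : ℕ} (hp : IndPath G p t)
    (hq : IndPath G q k) (ht : 1 ≤ t) (htk : 2 ≤ t + k) (hd : ∀ i ≤ k, ∀ l ≤ t, q i ≠ p l)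
    (ha : ∀ i ≤ k, ∀ l ≤ t, (G.Adj (q i) (p l) ↔ (i = 0 ∧ l = 0) ∨ (i = k ∧ l = t))) :
    IsHoleSet G (pts p 0 t ∪ pts q 0 k) := by
  have hset : pts p 0 t ∪ pts q 0 k =
      pts (fun l => if l ≤ t then p l else q (t + k + 1 - l)) 0 (t + k + 2 - 1) := by
    ext v
    constructor
    · rintro (⟨i, -, hi, rfl⟩ | ⟨i, -, hi, rfl⟩)
      · exact ⟨i, by omega, by omega, by simp [hi]⟩
      · refine ⟨t + k + 1 - i, by omega, by omega, ?_⟩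
        simp only
        rw [if_neg (by omega)]
        congr 1; omega
    · rintro ⟨i, -, hi, rfl⟩
      by_cases hit : i ≤ t
      · left; exact ⟨i, by omega, hit, by simp [hit]⟩
      · right; exact ⟨t + k + 1 - i, by omega, by omega, by simp [hit]⟩
  rw [hset]
  apply hole_of_enum (by omega)
  intro i j hij hj
  by_cases hi : i ≤ t
  · by_cases hjt : j ≤ t
    · simp only [hi, hjt, if_true]
      have := hp i j hi hjt hij
      refine ⟨this.1, this.2.trans ?_⟩
      omega
    · simp only [hi, hjt, if_true, if_false]
      refine ⟨(hd _ (by omega) _ hi).symm, ?_⟩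
      rw [G.adj_comm, ha _ (by omega) _ hi]
      omega
  · have hjt : ¬ j ≤ t := by omega
    simp only [hi, hjt, if_false]
    have := hq (t + k + 1 - j) (t + k + 1 - i) (by omega) (by omega) (by omega)
    refine ⟨this.1.symm, ?_⟩
    rw [G.adj_comm, this.2]
    omega

lemma Cyc_s9.window {G : SimpleGraph V} {p : ℕ → V} {n : ℕ} (h : Cyc_s9 G p n) (s t : ℕ)
    (ht : t ≤ n - 2) : IndPath G (fun i => p (s + i)) t := by
  intro i j hi hj hij
  obtain ⟨hn, hper, had⟩ := h
  have := had (s + i) (j - i) (by omega) (by omega)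
  rw [show s + i + (j - i) = s + j by omega] at this
  refine ⟨this.1, this.2.trans ?_⟩
  omega

lemma Cyc_s9.rot {G : SimpleGraph V} {p : ℕ → V} {n : ℕ} (h : Cyc_s9 G p n) (s : ℕ) :
    Cyc_s9 G (fun i => p (s + i)) n := by
  obtain ⟨hn, hper, had⟩ := h
  refine ⟨hn, fun i => ?_, fun i d => ?_⟩
  · simp only [← Nat.add_assoc]; exact hper (s + i)
  · simp only [← Nat.add_assoc]; exact had (s + i) d

lemma Cyc_s9.pts_eq {G : SimpleGraph V} {p : ℕ → V} {n : ℕ} (h : Cyc_s9 G p n) :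
    pts p 0 (n - 1) = Set.range p := by
  obtain ⟨hn, hper, had⟩ := h
  ext v
  constructor
  · rintro ⟨i, -, -, rfl⟩; exact ⟨i, rfl⟩
  · rintro ⟨i, rfl⟩
    refine ⟨i % n, by omega, by have := Nat.mod_lt i (show 0 < n by omega); omega, ?_⟩
    exact ((show Function.Periodic p n from hper).map_mod_nat i)

lemma Cyc_s9.rot_range {G : SimpleGraph V} {p : ℕ → V} {n : ℕ} (h : Cyc_s9 G p n) (s : ℕ) :
    Set.range (fun i => p (s + i)) = Set.range p := by
  ext v
  constructor
  · rintro ⟨i, rfl⟩; exact ⟨s + i, rfl⟩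
  · rintro ⟨i, rfl⟩
    obtain ⟨hn, hper, had⟩ := h
    refine ⟨i + s * n - s, ?_⟩
    have : s ≤ s * n := Nat.le_mul_of_pos_right _ (by omega)
    simp only
    rw [show s + (i + s * n - s) = i + s * n by omega]
    exact (show Function.Periodic p n from hper).nat_mul s i

lemma Cyc_s9.adj_iff {G : SimpleGraph V} {p : ℕ → V} {n : ℕ} (h : Cyc_s9 G p n) {i j : ℕ} (hij : i < j)
    (hj : j < n) : G.Adj (p i) (p j) ↔ j = i + 1 ∨ (i = 0 ∧ j = n - 1) := by
  obtain ⟨hn, hper, had⟩ := h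
  have := (had i (j - i) (by omega) (by omega)).2
  rw [show i + (j - i) = j by omega] at this
  rw [this]; omega

lemma Cyc_s9.ne {G : SimpleGraph V} {p : ℕ → V} {n : ℕ} (h : Cyc_s9 G p n) {i j : ℕ} (hij : i < j)
    (hj : j < n) : p i ≠ p j := by
  obtain ⟨hn, hper, had⟩ := h
  have := (had i (j - i) (by omega) (by omega)).1
  rwa [show i + (j - i) = j by omega] at this

lemma Cyc_s9.hole {G : SimpleGraph V} {p : ℕ → V} {n : ℕ} (h : Cyc_s9 G p n) :
    IsHoleSet G (Set.range p) := by
  rw [← h.pts_eq]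
  exact hole_of_enum h.1 (fun i j hij hj => ⟨h.ne hij hj, h.adj_iff hij hj⟩)

/-- There is a path from `u` to `v` with vertex set `S`. -/
def PathOn (G : SimpleGraph V) (u v : V) (S : Set V) : Prop :=
  ∃ W : G.Walk u v, W.IsPath ∧ ∀ w, w ∈ W.support ↔ w ∈ S

lemma PathOn.rev {G : SimpleGraph V} {u v : V} {S : Set V} (h : PathOn G u v S) :
    PathOn G v u S := by
  obtain ⟨W, hW, hs⟩ := h
  exact ⟨W.reverse, hW.reverse, by simpa using hs⟩

lemma PathOn.cons {G : SimpleGraph V} {u v w : V} {S : Set V} (h : PathOn G u v S)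
    (hw : G.Adj w u) (hS : w ∉ S) : PathOn G w v (insert w S) := by
  obtain ⟨W, hW, hs⟩ := h
  exact ⟨Walk.cons hw W, hW.cons (by rwa [hs]), by simp [hs]⟩

lemma PathOn.of_ind {G : SimpleGraph V} {p : ℕ → V} {t : ℕ} (h : IndPath G p t) :
    PathOn G (p 0) (p t) (pts p 0 t) := by
  induction t with
  | zero => exact ⟨Walk.nil, Walk.IsPath.nil, by simp [pts, eq_comm]⟩
  | succ t ih =>
    have := (ih (fun i j hi hj => h i j (by omega) (by omega))).rev.cons (w := p (t + 1))
      (((h t (t + 1) (by omega) le_rfl (by omega)).2.2 rfl).symm) (by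
        rintro ⟨i, -, hi, he⟩
        exact (h i (t + 1) (by omega) le_rfl (by omega)).1 he)
    convert this.rev using 1
    ext v
    constructor
    · rintro ⟨i, -, hi, rfl⟩
      rcases Nat.lt_or_ge t i with h' | h'
      · left; congr 1; omega
      · right; exact ⟨i, by omega, h', rfl⟩
    · rintro (rfl | ⟨i, -, hi, rfl⟩)
      · exact ⟨t + 1, by omega, le_rfl, rfl⟩
      · exact ⟨i, by omega, by omega, rfl⟩

lemma PathOn.window {G : SimpleGraph V} {p : ℕ → V} {n : ℕ} (h : Cyc_s9 G p n) {s e : ℕ} (hse : s ≤ e)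
    (he : e ≤ s + (n - 2)) : PathOn G (p s) (p e) (pts p s e) := by
  have := PathOn.of_ind (h.window s (e - s) (by omega))
  simp only [Nat.add_zero] at this
  rw [show s + (e - s) = e by omega] at this
  convert this using 1
  ext v
  constructor
  · rintro ⟨i, h1, h2, rfl⟩; exact ⟨i - s, by omega, by omega, by simp only; congr 1; omega⟩
  · rintro ⟨i, h1, h2, rfl⟩; exact ⟨s + i, by omega, by omega, rfl⟩

lemma theta_of {G : SimpleGraph V} {a b : V} {S₁ S₂ S₃ : Set V} (hab : a ≠ b) (hn : ¬ G.Adj a b)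
    (h₁ : PathOn G a b S₁) (h₂ : PathOn G a b S₂) (h₃ : PathOn G a b S₃)
    (h12 : IsHoleSet G (S₁ ∪ S₂)) (h13 : IsHoleSet G (S₁ ∪ S₃)) (h23 : IsHoleSet G (S₂ ∪ S₃)) :
    HasTheta G := by
  obtain ⟨W₁, p₁, s₁⟩ := h₁
  obtain ⟨W₂, p₂, s₂⟩ := h₂
  obtain ⟨W₃, p₃, s₃⟩ := h₃
  refine ⟨a, b, W₁, W₂, W₃, hab, hn, p₁, p₂, p₃, ?_, ?_, ?_⟩ <;> unfold PairHole
  · simp only [s₁, s₂]; exact h12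
  · simp only [s₁, s₃]; exact h13
  · simp only [s₂, s₃]; exact h23

lemma pyramid_of {G : SimpleGraph V} {a b₁ b₂ b₃ : V} {S₁ S₂ S₃ : Set V} (h₁₂ : G.Adj b₁ b₂)
    (h₁₃ : G.Adj b₁ b₃) (h₂₃ : G.Adj b₂ b₃) (n₁ : a ≠ b₁) (n₂ : a ≠ b₂) (n₃ : a ≠ b₃)
    (h₁ : PathOn G a b₁ S₁) (h₂ : PathOn G a b₂ S₂) (h₃ : PathOn G a b₃ S₃)
    (h12 : IsHoleSet G (S₁ ∪ S₂)) (h13 : IsHoleSet G (S₁ ∪ S₃)) (h23 : IsHoleSet G (S₂ ∪ S₃)) :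
    HasPyramid G := by
  obtain ⟨W₁, p₁, s₁⟩ := h₁
  obtain ⟨W₂, p₂, s₂⟩ := h₂
  obtain ⟨W₃, p₃, s₃⟩ := h₃
  refine ⟨a, b₁, b₂, b₃, W₁, W₂, W₃, h₁₂, h₁₃, h₂₃, n₁, n₂, n₃, p₁, p₂, p₃, ?_, ?_, ?_⟩ <;>
    unfold PairHole
  · simp only [s₁, s₂]; exact h12
  · simp only [s₁, s₃]; exact h13
  · simp only [s₂, s₃]; exact h23

lemma prism_of {G : SimpleGraph V} {a₁ a₂ a₃ b₁ b₂ b₃ : V} {S₁ S₂ S₃ : Set V}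
    (g₁₂ : G.Adj a₁ a₂) (g₁₃ : G.Adj a₁ a₃) (g₂₃ : G.Adj a₂ a₃) (h₁₂ : G.Adj b₁ b₂)
    (h₁₃ : G.Adj b₁ b₃) (h₂₃ : G.Adj b₂ b₃)
    (hd : ({a₁, a₂, a₃} : Set V) ∩ {b₁, b₂, b₃} = ∅)
    (h₁ : PathOn G a₁ b₁ S₁) (h₂ : PathOn G a₂ b₂ S₂) (h₃ : PathOn G a₃ b₃ S₃)
    (h12 : IsHoleSet G (S₁ ∪ S₂)) (h13 : IsHoleSet G (S₁ ∪ S₃)) (h23 : IsHoleSet G (S₂ ∪ S₃)) :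
    HasPrism G := by
  obtain ⟨W₁, p₁, s₁⟩ := h₁
  obtain ⟨W₂, p₂, s₂⟩ := h₂
  obtain ⟨W₃, p₃, s₃⟩ := h₃
  refine ⟨a₁, a₂, a₃, b₁, b₂, b₃, W₁, W₂, W₃, g₁₂, g₁₃, g₂₃, h₁₂, h₁₃, h₂₃, hd, p₁, p₂, p₃,
    ?_, ?_, ?_⟩ <;> unfold PairHole
  · simp only [s₁, s₂]; exact h12
  · simp only [s₁, s₃]; exact h13
  · simp only [s₂, s₃]; exact h23


lemma union_insert_mem {x : V} {X Z : Set V} (h : x ∈ X) : X ∪ insert x Z = X ∪ Z := by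
  rw [Set.union_insert, Set.insert_eq_of_mem (Set.mem_union_left _ h)]

/-- The main configuration lemma: a hole `p` together with a path `q` attached at both ends. -/
lemma truemper_of_attach {G : SimpleGraph V} {p q : ℕ → V} {n k m j j' : ℕ} (hC : Cyc_s9 G p n)
    (hq : IndPath G q k) (hd : ∀ i ≤ k, ∀ l, q i ≠ p l) (hm : m = n ∨ m = n - 1)
    (hj' : j' = j ∨ j' = j + 1) (hj : 1 ≤ j) (hjm : j' < m)
    (ha : ∀ i ≤ k, ∀ l < n, (G.Adj (q i) (p l) ↔
      (i = 0 ∧ (l = 0 ∨ l = m)) ∨ (i = k ∧ (l = j ∨ l = j'))))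
    (hex : m = n → j' = j → 2 ≤ j ∧ j ≤ n - 2)
    (hk : k = 0 → m = n ∧ j' = j) :
    HasTheta G ∨ HasPyramid G ∨ HasPrism G := by
  have hn : 4 ≤ n := hC.1
  have hpn : p n = p 0 := by simpa using hC.2.1 0
  -- adjacency on the extended range
  have ha' : ∀ i ≤ k, ∀ l, 1 ≤ l → l ≤ m → (G.Adj (q i) (p l) ↔
      (i = 0 ∧ l = m) ∨ (i = k ∧ (l = j ∨ l = j'))) := by
    intro i hi l hl hlm
    by_cases hln : l < n
    · rw [ha i hi l hln]; omega
    · have : l = n := by omega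
      rw [this, hpn, ha i hi 0 (by omega)]; omega
  have hX : IndPath G p j := by
    have := hC.window 0 j (by omega)
    simpa using this
  have hY := hC.window j' (m - j') (by omega)
  have XZ : IsHoleSet G (pts p 0 j ∪ pts q 0 k) := by
    apply hole_of_two hX hq hj (by omega) (fun i hi l _ => hd i hi l)
    intro i hi l hl
    rw [ha i hi l (by omega)]; omega
  have hYset : pts (fun i => p (j' + i)) 0 (m - j') = pts p j' m := by
    ext v
    constructor
    · rintro ⟨i, h1, h2, rfl⟩; exact ⟨j' + i, by omega, by omega, rfl⟩
    · rintro ⟨i, h1, h2, rfl⟩; exact ⟨i - j', by omega, by omega, by simp only; congr 1; omega⟩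
  have YZ : IsHoleSet G (pts p j' m ∪ pts q 0 k) := by
    rw [← hYset, ← pts_rev q k]
    apply hole_of_two hY hq.rev (by omega) (by omega) (fun i hi l _ => hd _ (by omega) _)
    intro i hi l hl
    rw [ha' (k - i) (by omega) _ (by omega) (by omega)]; omega
  have XY : IsHoleSet G (pts p 0 j ∪ pts p j' m) := by
    have : pts p 0 j ∪ pts p j' m = pts p 0 (n - 1) := by
      ext v
      constructor
      · rintro (⟨i, h1, h2, rfl⟩ | ⟨i, h1, h2, rfl⟩)
        · exact ⟨i, by omega, by omega, rfl⟩
        · by_cases hin : i < n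
          · exact ⟨i, by omega, by omega, rfl⟩
          · have : i = n := by omega
            exact ⟨0, by omega, by omega, by rw [this, hpn]⟩
      · rintro ⟨i, h1, h2, rfl⟩
        by_cases hij : i ≤ j
        · left; exact ⟨i, by omega, by omega, rfl⟩
        · right; exact ⟨i, by omega, by omega, rfl⟩
    rw [this, hC.pts_eq]
    exact hC.hole
  have W1 : PathOn G (p 0) (p j) (pts p 0 j) := PathOn.window hC (by omega) (by omega)
  have W2 : PathOn G (p m) (p j') (pts p j' m) := (PathOn.window hC (by omega) (by omega)).rev
  have W3 : PathOn G (q 0) (q k) (pts q 0 k) := PathOn.of_ind hq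
  have m0 : p 0 ∈ pts p 0 j := mem_pts le_rfl (by omega)
  have mj : p j ∈ pts p 0 j := mem_pts (by omega) (by omega)
  have mm : p m ∈ pts p j' m := mem_pts (by omega) (by omega)
  have mj' : p j' ∈ pts p j' m := mem_pts (by omega) (by omega)
  have hZ : ∀ l, p l ∉ pts q 0 k := by
    rintro l ⟨i, -, hi, he⟩
    exact hd i hi l he
  have a0 : G.Adj (p 0) (q 0) := ((ha 0 (by omega) 0 (by omega)).2 (by omega)).symm
  have am : G.Adj (p m) (q 0) := ((ha' 0 (by omega) m (by omega) (by omega)).2 (by omega)).symm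
  have aj : G.Adj (p j) (q k) := ((ha' k (by omega) j (by omega) (by omega)).2 (by omega)).symm
  have aj' : G.Adj (p j') (q k) := ((ha' k (by omega) j' (by omega) (by omega)).2 (by omega)).symm
  have n0j : p 0 ≠ p j := hC.ne (by omega) (by omega)
  rcases hm with rfl | rfl
  · rw [hpn] at W2 mm
    have W3' := W3.cons a0 (hZ 0)
    rcases hj' with rfl | rfl
    · left
      obtain ⟨h2, h3⟩ := hex rfl rfl
      have W3'' := (W3'.rev.cons aj (by
        rintro (h | h)
        · exact n0j h.symm
        · exact hZ _ h)).rev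
      refine theta_of n0j ?_ W1 W2 W3'' XY ?_ ?_
      · rw [hC.adj_iff (by omega) (by omega)]; omega
      · rw [union_insert_mem mj, union_insert_mem m0]; exact XZ
      · rw [union_insert_mem mj', union_insert_mem mm]; exact YZ
    · right; left
      refine pyramid_of ?_ aj aj' n0j (hC.ne (by omega) (by omega)) (hd k le_rfl 0).symm
        W1 W2 W3' XY ?_ ?_
      · rw [hC.adj_iff (by omega) (by omega)]; omega
      · rw [union_insert_mem m0]; exact XZ
      · rw [union_insert_mem mm]; exact YZ
  · have a0m : G.Adj (p 0) (p (n - 1)) := (hC.adj_iff (by omega) (by omega)).2 (by omega)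
    rcases hj' with rfl | rfl
    · right; left
      have W3' := W3.rev.cons aj (hZ _)
      refine pyramid_of a0m a0 am n0j.symm (hC.ne (by omega) (by omega)) (hd 0 (by omega) _).symm
        W1.rev W2.rev W3' XY ?_ ?_
      · rw [union_insert_mem mj]; exact XZ
      · rw [union_insert_mem mj']; exact YZ
    · right; right
      have hk0 : 0 < k := by
        rcases Nat.eq_zero_or_pos k with h | h
        · have := hk h; omega
        · exact h
      refine prism_of a0m a0 am ((hC.adj_iff (by omega) (by omega)).2 (by omega)) aj aj' ?_
        W1 W2 W3 XY XZ YZ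
      have e1 : p (n - 1) ≠ p j := (hC.ne (by omega) (by omega)).symm
      have e2 : p (n - 1) ≠ p (j + 1) := (hC.ne (by omega) (by omega)).symm
      have e3 : p 0 ≠ p (j + 1) := (hC.ne (by omega) (by omega))
      have e4 : q 0 ≠ q k := (hq 0 k (by omega) le_rfl hk0).1
      have e5 := hd 0 (by omega)
      have e6 := hd k (by omega)
      ext v
      simp only [Set.mem_inter_iff, Set.mem_insert_iff, Set.mem_singleton_iff,
        Set.mem_empty_iff_false, iff_false]
      rintro ⟨rfl | rfl | rfl, h | h | h⟩
      all_goals first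
        | exact n0j h | exact e1 h | exact e2 h | exact e3 h | exact e4 h | exact e5 _ h
        | exact e6 _ h.symm


/-! ### Attachments to a hole -/

/-- A shortest chain is an induced path. -/
lemma exists_ind {G : SimpleGraph V} {X : Set V} : ∀ (k : ℕ) (q : ℕ → V), (∀ i ≤ k, q i ∈ X) →
    (∀ i < k, G.Adj (q i) (q (i + 1))) →
    ∃ k' ≤ k, ∃ q' : ℕ → V, IndPath G q' k' ∧ (∀ i ≤ k', q' i ∈ X) ∧ q' 0 = q 0 ∧ q' k' = q k := by
  intro k
  induction k using Nat.strong_induction_on with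
  | _ k ih =>
  intro q hX hq
  by_cases hind : IndPath G q k
  · exact ⟨k, le_rfl, q, hind, hX, rfl, rfl⟩
  · simp only [IndPath, not_forall] at hind
    obtain ⟨i, j, hi, hj, hij, hbad⟩ := hind
    by_cases heq : q i = q j
    · obtain ⟨k', hk', q', h1, h2, h3, h4⟩ := ih (k - (j - i)) (by omega)
        (fun l => if l < i then q l else q (l + (j - i)))
        (by
          intro l hl
          try simp only
          split_ifs
          · exact hX _ (by omega)
          · exact hX _ (by omega))
        (by
          intro l hl
          try simp only
          split_ifs with h1 h2 h2
          · exact hq _ (by omega)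
          · have e : l + 1 = i := by omega
            have e2 : l + 1 + (j - i) = j := by omega
            rw [e2, ← heq, ← e]
            exact hq _ (by omega)
          · omega
          · rw [show l + 1 + (j - i) = l + (j - i) + 1 by omega]
            exact hq _ (by omega))
      refine ⟨k', by omega, q', h1, h2, ?_, ?_⟩
      · rw [h3]
        try simp only
        split_ifs with h
        · rfl
        · have : i = 0 := by omega
          subst this
          rw [show 0 + (j - 0) = j by omega, heq]
      · rw [h4]
        try simp only
        rw [if_neg (by omega)]
        congr 1; omega
    · have hadj : G.Adj (q i) (q j) ∧ j ≠ i + 1 := by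
        by_contra hcon
        apply hbad
        refine ⟨heq, fun h => ?_, ?_⟩
        · by_contra h'
          exact hcon ⟨h, h'⟩
        · rintro rfl
          exact hq _ (by omega)
      obtain ⟨k', hk', q', h1, h2, h3, h4⟩ := ih (k - (j - i - 1)) (by omega)
        (fun l => if l ≤ i then q l else q (l + (j - i - 1)))
        (by
          intro l hl
          try simp only
          split_ifs
          · exact hX _ (by omega)
          · exact hX _ (by omega))
        (by
          intro l hl
          try simp only
          split_ifs with h1 h2 h2
          · exact hq _ (by omega)
          · have e : l = i := by omega
            have e2 : l + 1 + (j - i - 1) = j := by omega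
            rw [e2, e]
            exact hadj.1
          · omega
          · rw [show l + 1 + (j - i - 1) = l + (j - i - 1) + 1 by omega]
            exact hq _ (by omega))
      refine ⟨k', by omega, q', h1, h2, ?_, ?_⟩
      · rw [h3]; simp
      · rw [h4]
        try simp only
        rw [if_neg (by omega)]
        congr 1; omega

lemma Cyc_s9.exists_off {G : SimpleGraph V} {p : ℕ → V} {n : ℕ} (h : Cyc_s9 G p n) (s : ℕ) {v : V}
    (hv : v ∈ Set.range p) : ∃ d < n, v = p (s + d) := by
  rw [← h.rot_range s, ← (h.rot s).pts_eq] at hv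
  obtain ⟨d, -, hd, rfl⟩ := hv
  have := h.1
  exact ⟨d, by omega, rfl⟩

lemma Cyc_s9.exists_adj {G : SimpleGraph V} {p : ℕ → V} {n : ℕ} (h : Cyc_s9 G p n) (s : ℕ) {v : V}
    (hv : v ∈ Set.range p) (ha : G.Adj (p s) v) : v = p (s + 1) ∨ v = p (s + (n - 1)) := by
  obtain ⟨d, hd, rfl⟩ := h.exists_off s hv
  rcases Nat.eq_zero_or_pos d with rfl | hpos
  · simp at ha
  · rcases ((h.2.2 s d hpos hd).2.1 ha) with rfl | rfl <;> simp

lemma Cyc_s9.not_adj {G : SimpleGraph V} {p : ℕ → V} {n : ℕ} (h : Cyc_s9 G p n) (s : ℕ) :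
    ¬ G.Adj (p (s + 1)) (p (s + (n - 1))) := by
  have hn := h.1
  have := (h.2.2 (s + 1) (n - 2) (by omega) (by omega)).2
  rw [show s + 1 + (n - 2) = s + (n - 1) by omega] at this
  rw [this]; omega

lemma Cyc_s9.no_triangle {G : SimpleGraph V} {p : ℕ → V} {n : ℕ} (h : Cyc_s9 G p n) {a b c : V}
    (ha : a ∈ Set.range p) (hb : b ∈ Set.range p) (hc : c ∈ Set.range p) (hab : G.Adj a b)
    (hac : G.Adj a c) (hbc : G.Adj b c) : False := by
  obtain ⟨s, rfl⟩ := ha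
  rcases h.exists_adj s hb hab with rfl | rfl <;> rcases h.exists_adj s hc hac with rfl | rfl
  · exact G.loopless.irrefl _ hbc
  · exact h.not_adj s hbc
  · exact h.not_adj s hbc.symm
  · exact G.loopless.irrefl _ hbc

lemma Cyc_s9.clique {G : SimpleGraph V} {p : ℕ → V} {n : ℕ} (h : Cyc_s9 G p n) {A : Set V}
    (hA : A ⊆ Set.range p) (hne : A.Nonempty) (hc : ∀ a ∈ A, ∀ b ∈ A, a = b ∨ G.Adj a b) :
    ∃ s < n, ∃ e, (e = s ∨ e = s + 1) ∧ A = {p s, p e} := by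
  have hn := h.1
  suffices H : ∃ s e, (e = s ∨ e = s + 1) ∧ A = {p s, p e} by
    obtain ⟨s, e, he, rfl⟩ := H
    have hper : Function.Periodic p n := h.2.1
    refine ⟨s % n, Nat.mod_lt _ (by omega), s % n + (e - s), by omega, ?_⟩
    rw [hper.map_mod_nat]
    have : p (s % n + (e - s)) = p e := by
      have h1 := (show Function.Periodic (fun i => p (i + (e - s))) n by
        intro i
        try simp only
        rw [show i + n + (e - s) = i + (e - s) + n by omega, hper]).map_mod_nat s
      try simp only at h1
      rw [h1]; congr 1; omega
    rw [this]
  obtain ⟨a, ha⟩ := hne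
  obtain ⟨s, rfl⟩ := hA ha
  by_cases hb : ∃ b ∈ A, b ≠ p s
  · obtain ⟨b, hbA, hbs⟩ := hb
    have hab := (hc _ ha _ hbA).resolve_left (Ne.symm hbs)
    have hall : A = {p s, b} := by
      ext c
      constructor
      · intro hcA
        by_contra hcon
        simp only [Set.mem_insert_iff, Set.mem_singleton_iff, not_or] at hcon
        exact h.no_triangle (hA ha) (hA hbA) (hA hcA) hab
          ((hc _ ha _ hcA).resolve_left (Ne.symm hcon.1))
          ((hc _ hbA _ hcA).resolve_left (Ne.symm hcon.2))
      · rintro (rfl | rfl) <;> assumption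
    rcases h.exists_adj s (hA hbA) hab with rfl | rfl
    · exact ⟨s, s + 1, Or.inr rfl, hall⟩
    · refine ⟨s + (n - 1), s + (n - 1) + 1, Or.inr rfl, ?_⟩
      rw [hall, Set.pair_comm]
      rw [show s + (n - 1) + 1 = s + n by omega, h.2.1]
  · refine ⟨s, s, Or.inl rfl, ?_⟩
    ext c
    constructor
    · intro hcA
      by_contra hcon
      exact hb ⟨c, hcA, fun e => hcon (by simp [e])⟩
    · rintro (rfl | rfl) <;> assumption

lemma wheel_of [Finite V] {G : SimpleGraph V} {S : Set V} {v x y z : V} (hS : IsHoleSet G S)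
    (hv : v ∉ S) (hx : x ∈ S) (hy : y ∈ S) (hz : z ∈ S) (ax : G.Adj v x) (ay : G.Adj v y)
    (az : G.Adj v z) (hxy : x ≠ y) (hxz : x ≠ z) (hyz : y ≠ z) : HasWheel G := by
  refine ⟨S, v, hS, hv, ?_⟩
  have h3 : ({x, y, z} : Set V).ncard = 3 := Set.ncard_eq_three.2 ⟨x, y, z, hxy, hxz, hyz, rfl⟩
  rw [← h3]
  apply Set.ncard_le_ncard _ (Set.toFinite _)
  rintro w (rfl | rfl | rfl)
  · exact ⟨hx, ax⟩
  · exact ⟨hy, ay⟩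
  · exact ⟨hz, az⟩

/-- A chain outside `H` of length `k` attached at both ends to nonadjacent vertices of `H`. -/
def Att (G : SimpleGraph V) (H : Set V) (k : ℕ) : Prop :=
  ∃ (q : ℕ → V) (x y : V), (∀ i ≤ k, q i ∉ H) ∧ (∀ i < k, G.Adj (q i) (q (i + 1))) ∧ x ∈ H ∧ y ∈ H ∧
    x ≠ y ∧ ¬ G.Adj x y ∧ G.Adj (q 0) x ∧ G.Adj (q k) y

lemma no_att [Finite V] {G : SimpleGraph V} (hθ : ¬ HasTheta G) (hpy : ¬ HasPyramid G)
    (hpr : ¬ HasPrism G) (hw : ¬ HasWheel G) {p : ℕ → V} {n : ℕ} (hC : Cyc_s9 G p n) (k : ℕ) :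
    ¬ Att G (Set.range p) k := by
  induction k using Nat.strong_induction_on with
  | _ k hmin =>
  rintro ⟨q₀, x, y, hq₀, hch, hx, hy, hxy, hnxy, hqx, hqy⟩
  have hn := hC.1
  -- pass to an induced path
  obtain ⟨k', hk', q, hind, hqH, e0, ek⟩ := exists_ind (G := G) (X := (Set.range p)ᶜ) k q₀ hq₀ hch
  rw [← e0] at hqx
  rw [← ek] at hqy
  have hadj : ∀ i < k', G.Adj (q i) (q (i + 1)) := fun i hi =>
    (hind i (i + 1) (by omega) (by omega) (by omega)).2.2 rfl
  have hkk : k' = k := by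
    by_contra hne
    exact hmin k' (by omega) ⟨q, x, y, hqH, hadj, hx, hy, hxy, hnxy, hqx, hqy⟩
  subst hkk
  clear hch hq₀ e0 ek q₀
  have hd : ∀ i ≤ k', ∀ l, q i ≠ p l := fun i hi l h => hqH i hi ⟨l, h.symm⟩
  have hnc : ¬ (HasTheta G ∨ HasPyramid G ∨ HasPrism G) := by tauto
  -- master claim
  have master : ∀ i j, i ≤ j → j ≤ k' → j - i < k' → ∀ u ∈ Set.range p, ∀ w ∈ Set.range p,
      G.Adj (q i) u → G.Adj (q j) w → u = w ∨ G.Adj u w := by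
    intro i j hij hj hlt u hu w hw' hiu hjw
    by_contra hcon
    push Not at hcon
    refine hmin (j - i) hlt ⟨fun l => q (i + l), u, w, fun l hl => hqH _ (by omega),
      fun l hl => hadj _ (by omega), hu, hw', hcon.1, hcon.2, by simpa using hiu, ?_⟩
    try simp only
    rwa [show i + (j - i) = j by omega]
  have inj : ∀ {p' : ℕ → V}, Cyc_s9 G p' n → ∀ l l', l < n → l' < n → (p' l = p' l' ↔ l = l') := by
    intro p' hp' l l' hl hl'
    refine ⟨fun h => ?_, fun h => by rw [h]⟩
    by_contra hne
    rcases Nat.lt_or_gt_of_ne hne with h' | h'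
    · exact hp'.ne h' hl' h
    · exact hp'.ne h' hl h.symm
  rcases Nat.eq_zero_or_pos k' with hk0 | hkpos
  · -- a single vertex
    subst hk0
    have honly : ∀ z ∈ Set.range p, G.Adj (q 0) z → z = x ∨ z = y := by
      intro z hz hqz
      by_contra hcon
      push Not at hcon
      exact hw (wheel_of hC.hole (hqH 0 le_rfl) hx hy hz hqx hqy hqz hxy (Ne.symm hcon.1)
        (Ne.symm hcon.2))
    obtain ⟨s, rfl⟩ := hx
    obtain ⟨j, hj, rfl⟩ := hC.exists_off s hy
    have hR := hC.rot s
    have hj0 : j ≠ 0 := by rintro rfl; exact hxy rfl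
    have hj2 : 2 ≤ j ∧ j ≤ n - 2 := by
      have := (hC.2.2 s j (by omega) hj).2
      rw [this] at hnxy
      omega
    refine hnc (truemper_of_attach (m := n) (j := j) (j' := j) hR hind (fun i hi l => hd i hi _) (Or.inl rfl)
      (Or.inl rfl) (by omega) hj ?_ (fun _ _ => hj2) (fun _ => ⟨rfl, rfl⟩))
    intro i hi l hl
    have hi0 : i = 0 := by omega
    subst hi0
    constructor
    · intro h
      rcases honly _ ⟨_, rfl⟩ h with h' | h'
      · have := (inj hR l 0 hl (by omega)).1 h'
        omega
      · have := (inj hR l j hl hj).1 h'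
        omega
    · rintro (⟨-, rfl | rfl⟩ | ⟨-, h⟩)
      · exact hqx
      · omega
      · have : l = j := by omega
        subst this; exact hqy
  · -- at least two vertices
    have hxA : ∀ i, 1 ≤ i → i ≤ k' → ¬ G.Adj (q i) x := by
      intro i h1 h2 h
      rcases master i k' h2 le_rfl (by omega) x hx y hy h hqy with h' | h'
      · exact hxy h'
      · exact hnxy h'
    have hyA : ∀ i, i < k' → ¬ G.Adj (q i) y := by
      intro i h2 h
      rcases master 0 i (by omega) (by omega) (by omega) x hx y hy hqx h with h' | h'
      · exact hxy h'
      · exact hnxy h'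
    by_cases hz : ∃ z ∈ Set.range p, (∃ i < k', G.Adj (q i) z) ∧ ∃ i, 1 ≤ i ∧ i ≤ k' ∧ G.Adj (q i) z
    · -- wheel with hub `z`
      obtain ⟨z, hz, ⟨i₁, hi₁, hz₁⟩, ⟨i₂, hi₂, hi₂', hz₂⟩⟩ := hz
      have hxz : G.Adj x z := by
        refine (master 0 i₁ (by omega) (by omega) (by omega) x hx z hz hqx hz₁).resolve_left ?_
        rintro rfl; exact hxA i₂ hi₂ hi₂' hz₂
      have hzy : G.Adj z y := by
        refine (master i₂ k' (by omega) (by omega) (by omega) z hz y hy hz₂ hqy).resolve_left ?_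
        rintro rfl; exact hyA i₁ hi₁ hz₁
      have hchar : ∀ u ∈ Set.range p, u ≠ z → ∀ i ≤ k',
          (G.Adj (q i) u ↔ (i = 0 ∧ u = x) ∨ (i = k' ∧ u = y)) := by
        intro u hu huz i hi
        constructor
        · intro hiu
          by_cases hik : i < k'
          · have hux : u = x := by
              by_contra hux
              have h1 := (master 0 i (by omega) (by omega) (by omega) x hx u hu hqx hiu).resolve_left
                (Ne.symm hux)
              have h2 : z = u ∨ G.Adj z u := by
                rcases Nat.le_total i i₁ with h | h
                · rcases master i i₁ h (by omega) (by omega) u hu z hz hiu hz₁ with h | h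
                  · exact Or.inl h.symm
                  · exact Or.inr h.symm
                · exact master i₁ i h (by omega) (by omega) z hz u hu hz₁ hiu
              exact hC.no_triangle hx hz hu hxz h1 (h2.resolve_left (Ne.symm huz))
            subst hux
            left
            refine ⟨?_, rfl⟩
            by_contra h0
            exact hxA i (by omega) hi hiu
          · have hik : i = k' := by omega
            subst hik
            right
            refine ⟨rfl, ?_⟩
            by_contra huy
            have h1 := (master i i (by omega) (by omega) (by omega) u hu y hy hiu hqy).resolve_left
                huy
            have h2 := (master i₂ i (by omega) (by omega) (by omega) z hz u hu hz₂ hiu).resolve_left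
                (Ne.symm huz)
            exact hC.no_triangle hz hu hy h2 hzy h1
        · rintro (⟨rfl, rfl⟩ | ⟨rfl, rfl⟩) <;> assumption
      obtain ⟨s, rfl⟩ := hz
      have hR := hC.rot s
      have hP := hC.window (s + 1) (n - 2) le_rfl
      have hPz : ∀ l ≤ n - 2, p (s + 1 + l) ≠ p s := by
        intro l hl
        have := (hC.2.2 s (1 + l) (by omega) (by omega)).1
        rw [← Nat.add_assoc] at this
        exact this.symm
      have hPinj : ∀ l ≤ n - 2, ∀ l' ≤ n - 2, (p (s + 1 + l) = p (s + 1 + l') ↔ l = l') := by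
        intro l hl l' hl'
        have := inj (hC.rot (s + 1)) l l' (by omega) (by omega)
        exact this
      have hlast : p (s + (n - 1)) = p (s + 1 + (n - 2)) := by congr 1; omega
      have hfirst : p (s + 1) = p (s + 1 + 0) := rfl
      have hhole : IsHoleSet G (pts (fun l => p (s + 1 + l)) 0 (n - 2) ∪ pts q 0 k') := by
        rcases hC.exists_adj s hx hxz.symm with rfl | rfl <;>
          rcases hC.exists_adj s hy hzy with rfl | rfl
        · exact absurd rfl hxy
        · apply hole_of_two hP hind (by omega) (by omega) (fun i hi l _ => hd i hi _)
          intro i hi l hl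
          rw [hchar _ ⟨_, rfl⟩ (hPz l hl) i hi, hlast, hfirst, hPinj l hl _ (by omega),
            hPinj l hl _ (by omega)]
        · rw [← pts_rev q k']
          apply hole_of_two hP hind.rev (by omega) (by omega) (fun i hi l _ => hd _ (by omega) _)
          intro i hi l hl
          rw [hchar _ ⟨_, rfl⟩ (hPz l hl) (k' - i) (by omega), hlast, hfirst,
            hPinj l hl _ (by omega), hPinj l hl _ (by omega)]
          omega
        · exact absurd rfl hxy
      have hmem : ∀ u ∈ Set.range p, u ≠ p s →
          u ∈ pts (fun l => p (s + 1 + l)) 0 (n - 2) ∪ pts q 0 k' := by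
        intro u hu hus
        left
        obtain ⟨d, hd', rfl⟩ := hC.exists_off s hu
        have : d ≠ 0 := by rintro rfl; exact hus rfl
        exact ⟨d - 1, by omega, by omega, by simp only; congr 1; omega⟩
      refine hw (wheel_of (v := p s) (x := x) (y := y) (z := q i₁) hhole ?_ (hmem x hx hxz.ne)
        (hmem y hy hzy.ne') (Or.inr (mem_pts (by omega) (by omega))) hxz.symm hzy hz₁.symm hxy ?_ ?_)
      · rintro (⟨l, -, hl, he⟩ | ⟨i, -, hi, he⟩)
        · exact hPz l hl he
        · exact hd i hi _ he
      · rintro rfl; exact hqH i₁ (by omega) hx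
      · rintro rfl; exact hqH i₁ (by omega) hy
    · -- theta, pyramid or prism
      have hdisj : ∀ z ∈ Set.range p, ∀ i < k', G.Adj (q i) z → ∀ i', 1 ≤ i' → i' ≤ k' →
          ¬ G.Adj (q i') z := by
        intro z hz' i hi h1 i' hi' hi'' h2
        exact hz ⟨z, hz', ⟨i, hi, h1⟩, i', hi', hi'', h2⟩
      have hchar : ∀ u ∈ Set.range p, ∀ i ≤ k',
          (G.Adj (q i) u ↔ (i = 0 ∧ G.Adj (q 0) u) ∨ (i = k' ∧ G.Adj (q k') u)) := by
        intro u hu i hi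
        constructor
        · intro h
          by_cases h0 : i = 0
          · subst h0; exact Or.inl ⟨rfl, h⟩
          · by_cases h1 : i = k'
            · subst h1; exact Or.inr ⟨rfl, h⟩
            · exact absurd h (hdisj u hu i (by omega) h i (by omega) hi)
        · rintro (⟨rfl, h⟩ | ⟨rfl, h⟩) <;> exact h
      -- first attachment
      have hA₁ : ∃ p' : ℕ → V, Cyc_s9 G p' n ∧ Set.range p' = Set.range p ∧ ∃ m, (m = n ∨ m = n - 1) ∧
          {u | u ∈ Set.range p ∧ G.Adj (q 0) u} = {p' 0, p' m} := by
        obtain ⟨s, hs, e, he, hA⟩ := hC.clique (A := {u | u ∈ Set.range p ∧ G.Adj (q 0) u})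
          (fun u hu => hu.1) ⟨x, hx, hqx⟩
          (fun a ha b hb => master 0 0 le_rfl (by omega) (by omega) a ha.1 b hb.1 ha.2 hb.2)
        rcases he with rfl | rfl
        · refine ⟨_, hC.rot e, hC.rot_range e, n, Or.inl rfl, ?_⟩
          rw [hA, hC.2.1]; simp
        · refine ⟨_, hC.rot (s + 1), hC.rot_range (s + 1), n - 1, Or.inr rfl, ?_⟩
          rw [hA, Set.pair_comm]
          simp only [Nat.add_zero]
          rw [show s + 1 + (n - 1) = s + n by omega, hC.2.1]
      obtain ⟨p', hC', hrange, m, hm, hA₁⟩ := hA₁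
      rw [← hrange] at hx hy hqH master hdisj hchar hA₁
      obtain ⟨j, hj, j', hj', hA₂⟩ := hC'.clique (A := {u | u ∈ Set.range p' ∧ G.Adj (q k') u})
          (fun u hu => hu.1) ⟨y, hy, hqy⟩
          (fun a ha b hb => master k' k' le_rfl (by omega) (by omega) a ha.1 b hb.1 ha.2 hb.2)
      have hpn : p' n = p' 0 := by simpa using hC'.2.1 0
      have mem₁ : ∀ l, G.Adj (q 0) (p' l) ↔ p' l = p' 0 ∨ p' l = p' m := by
        intro l
        have := Set.ext_iff.1 hA₁ (p' l)
        simpa using this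
      have mem₂ : ∀ l, G.Adj (q k') (p' l) ↔ p' l = p' j ∨ p' l = p' j' := by
        intro l
        have := Set.ext_iff.1 hA₂ (p' l)
        simpa using this
      have hdis : ∀ l, G.Adj (q 0) (p' l) → ¬ G.Adj (q k') (p' l) := fun l h =>
        hdisj _ ⟨l, rfl⟩ 0 hkpos h k' hkpos le_rfl
      have d0 := hdis 0 ((mem₁ 0).2 (Or.inl rfl))
      have dm := hdis m ((mem₁ m).2 (Or.inr rfl))
      have hj1 : j ≠ 0 := by
        rintro rfl; exact d0 ((mem₂ 0).2 (Or.inl rfl))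
      have hj'n : j' ≠ n := by
        rintro rfl; exact d0 ((mem₂ 0).2 (Or.inr hpn.symm))
      have hjm : j ≠ m := by
        rintro rfl; exact dm ((mem₂ j).2 (Or.inl rfl))
      have hj'm : j' ≠ m := by
        rintro rfl; exact dm ((mem₂ j').2 (Or.inr rfl))
      have idx₁ : ∀ l < n, (G.Adj (q 0) (p' l) ↔ l = 0 ∨ l = m) := by
        intro l hl
        rw [mem₁, inj hC' l 0 hl (by omega)]
        rcases hm with rfl | rfl
        · rw [hpn, inj hC' l 0 hl (by omega)]; omega
        · rw [inj hC' l (n - 1) hl (by omega)]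
      have idx₂ : ∀ l < n, (G.Adj (q k') (p' l) ↔ l = j ∨ l = j') := by
        intro l hl
        rw [mem₂, inj hC' l j hl hj, inj hC' l j' hl (by omega)]
      refine hnc (truemper_of_attach (m := m) (j := j) (j' := j') hC' hind
        (fun i hi l h => hqH i hi ⟨l, h.symm⟩) hm hj' (by omega) (by omega) ?_ ?_ (by omega))
      · intro i hi l hl
        rw [hchar _ ⟨l, rfl⟩ i hi, idx₁ l hl, idx₂ l hl]
      · rintro rfl rfl
        have hx0 : x = p' 0 := by
          have := (Set.ext_iff.1 hA₁ x).1 ⟨hx, hqx⟩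
          rw [hpn] at this
          simpa using this
        have hyj : y = p' j' := by
          have := (Set.ext_iff.1 hA₂ y).1 ⟨hy, hqy⟩
          simpa using this
        rw [hx0, hyj, hC'.adj_iff (by omega) hj] at hnxy
        omega


/-! ### The main induction -/

/-- The component of `b` in `X`. -/
def comp (G : SimpleGraph V) (X : Set V) (b : V) : Set V :=
  {v | Relation.ReflTransGen (fun u v => G.Adj u v ∧ u ∈ X ∧ v ∈ X) b v}

lemma comp_self {G : SimpleGraph V} {X : Set V} {b : V} : b ∈ comp G X b :=
  Relation.ReflTransGen.refl

lemma comp_sub {G : SimpleGraph V} {X : Set V} {b : V} (hb : b ∈ X) : comp G X b ⊆ X := by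
  intro v hv
  rcases Relation.ReflTransGen.cases_tail hv with rfl | ⟨c, -, h⟩
  · exact hb
  · exact h.2.2

lemma comp_closed {G : SimpleGraph V} {X : Set V} {b u v : V} (hb : b ∈ X) (hu : u ∈ comp G X b)
    (hv : v ∈ X) (h : G.Adj u v) : v ∈ comp G X b :=
  Relation.ReflTransGen.tail hu ⟨h, comp_sub hb hu, hv⟩

lemma comp_conn {G : SimpleGraph V} {X : Set V} {b u v : V} (hu : u ∈ comp G X b)
    (hv : v ∈ comp G X b) : ∃ (k : ℕ) (q : ℕ → V), q 0 = u ∧ q k = v ∧ (∀ i ≤ k, q i ∈ comp G X b) ∧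
      ∀ i < k, G.Adj (q i) (q (i + 1)) := by
  have hsymm : Relation.ReflTransGen (fun u v => G.Adj u v ∧ u ∈ X ∧ v ∈ X) u b := by
    have hs : Std.Symm (fun u v => G.Adj u v ∧ u ∈ X ∧ v ∈ X) :=
      ⟨fun x y h => ⟨h.1.symm, h.2.2, h.2.1⟩⟩
    exact Relation.ReflTransGen.stdSymm.symm _ _ hu
  have huv := hsymm.trans hv
  clear hv hsymm
  induction huv with
  | refl => exact ⟨0, fun _ => u, rfl, rfl, fun _ _ => hu, fun i hi => absurd hi (by omega)⟩
  | @tail c d _ hcd ih =>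
    obtain ⟨k, q, h0, hk, hC, hq⟩ := ih
    have hc : c ∈ comp G X b := by rw [← hk]; exact hC k le_rfl
    refine ⟨k + 1, fun i => if i ≤ k then q i else d, by simpa using h0, by simp, ?_, ?_⟩
    · intro i hi
      beta_reduce
      split_ifs with h
      · exact hC i h
      · exact Relation.ReflTransGen.tail hc hcd
    · intro i hi
      beta_reduce
      rw [if_pos (by omega)]
      split_ifs with h
      · exact hq i (by omega)
      · have : i = k := by omega
        subst this
        rw [hk]; exact hcd.1

lemma Dec.fan {G : SimpleGraph V} {p : ℕ → V} {n : ℕ} (h : Cyc_s9 G p n) :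
    Dec G (GoodBag G) (Set.range p) := by
  have hn := h.1
  let F : SimpleGraph V :=
    { Adj := fun u v => G.Adj u v ∨ (u ≠ v ∧ (u = p 0 ∨ v = p 0))
      symm := ⟨by
        rintro u v (h | ⟨h, h'⟩)
        · exact Or.inl h.symm
        · exact Or.inr ⟨h.symm, h'.symm⟩⟩
      loopless := ⟨by
        rintro u (h | ⟨h, -⟩)
        · exact G.loopless.irrefl _ h
        · exact h rfl⟩ }
  have hle : G ≤ F := fun u v huv => Or.inl huv
  have key : ∀ k, k + 1 ≤ n - 1 → Dec F (GoodBag G) (pts p 0 (k + 1)) := by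
    intro k
    induction k with
    | zero =>
      intro _
      apply Dec.base
      refine Or.inr ⟨p 0, p 1, p 1, (h.adj_iff (by omega) (by omega)).2 (Or.inl rfl), ?_⟩
      ext v
      simp only [Set.mem_insert_iff, Set.mem_singleton_iff, or_self]
      constructor
      · rintro ⟨i, -, hi, rfl⟩
        have : i = 0 ∨ i = 1 := by omega
        rcases this with rfl | rfl <;> simp
      · rintro (rfl | rfl)
        · exact ⟨0, by omega, by omega, rfl⟩
        · exact ⟨1, by omega, by omega, rfl⟩
    | succ k ih =>
      intro hk
      have ih := ih (by omega)
      have hB : Dec F (GoodBag G) {p (k + 1), p (k + 2), p 0} :=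
        Dec.base (Or.inr ⟨_, _, _, (h.adj_iff (by omega) (by omega)).2 (Or.inl rfl), rfl⟩)
      have hnot : p (k + 2) ∉ pts p 0 (k + 1) := by
        rintro ⟨i, -, hi, he⟩
        exact h.ne (show i < k + 2 by omega) (by omega) he
      have := ih.glue hB (by
        have hsub : ∀ v, v ∈ pts p 0 (k + 1) ∩ {p (k + 1), p (k + 2), p 0} →
            v = p (k + 1) ∨ v = p 0 := by
          rintro v ⟨h1, rfl | rfl | rfl⟩
          · exact Or.inl rfl
          · exact absurd h1 hnot
          · exact Or.inr rfl
        intro u hu v hv huv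
        rcases hsub u hu with rfl | rfl
        · rcases hsub v hv with rfl | rfl
          · exact absurd rfl huv
          · exact Or.inr ⟨huv, Or.inr rfl⟩
        · exact Or.inr ⟨huv, Or.inl rfl⟩) (by
        rintro a ⟨i, -, hi, rfl⟩ ha b hb hb' hab
        simp only [Set.mem_insert_iff, Set.mem_singleton_iff, not_or] at ha
        have hb2 : b = p (k + 2) := by
          rcases hb with rfl | rfl | rfl
          · exact absurd (mem_pts (by omega) le_rfl) hb'
          · rfl
          · exact absurd (mem_pts (by omega) (by omega)) hb'
        subst hb2
        rcases hab with hab | ⟨-, hab | hab⟩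
        · rw [h.adj_iff (by omega) (by omega)] at hab
          rcases hab with hab | ⟨rfl, -⟩
          · have : i = k + 1 := by omega
            subst this
            exact ha.1 rfl
          · exact ha.2.2 rfl
        · exact ha.2.2 hab
        · exact h.ne (show 0 < k + 2 by omega) (by omega) hab.symm)
      convert this using 1
      ext v
      constructor
      · rintro ⟨i, -, hi, rfl⟩
        by_cases hi2 : i = k + 2
        · subst hi2; exact Or.inr (Or.inr (Or.inl rfl))
        · exact Or.inl (mem_pts (by omega) (by omega))
      · rintro (⟨i, -, hi, rfl⟩ | rfl | rfl | rfl)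
        · exact mem_pts (by omega) (by omega)
        · exact mem_pts (by omega) (by omega)
        · exact mem_pts (by omega) (by omega)
        · exact mem_pts (by omega) (by omega)
  have := key (n - 2) (by omega)
  rw [show n - 2 + 1 = n - 1 by omega, h.pts_eq] at this
  exact this.mono hle

lemma Dec.step {G : SimpleGraph V} {S C : Set V} (ih : ∀ T, T < S → Dec G (GoodBag G) T)
    (hCS : C ⊆ S) (hne : C.Nonempty) {a : V} (haS : a ∈ S) (haC : a ∉ C)
    (haK : ∀ u ∈ C, ¬ G.Adj u a)
    (hK : G.IsClique {v | v ∈ S ∧ v ∉ C ∧ ∃ u ∈ C, G.Adj u v}) : Dec G (GoodBag G) S := by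
  set K : Set V := {v | v ∈ S ∧ v ∉ C ∧ ∃ u ∈ C, G.Adj u v} with hKdef
  have hA : Dec G (GoodBag G) (C ∪ K) := by
    apply ih
    refine ⟨?_, fun hsub => ?_⟩
    · rintro v (h | h)
      · exact hCS h
      · exact h.1
    · rcases hsub haS with h | ⟨-, -, u, hu, h⟩
      · exact haC h
      · exact haK u hu h
  have hB : Dec G (GoodBag G) (S \ C) := by
    apply ih
    obtain ⟨c, hc⟩ := hne
    exact ⟨fun v hv => hv.1, fun hsub => (hsub (hCS hc)).2 hc⟩
  have := hA.glue hB (by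
    refine hK.subset ?_
    rintro v ⟨h1 | h1, h2⟩
    · exact absurd h1 h2.2
    · exact h1) (by
    rintro u hu hu' v hv hv' huv
    have huC : u ∈ C := by
      rcases hu with h | h
      · exact h
      · exact absurd ⟨h.1, h.2.1⟩ hu'
    exact hv' (Or.inr ⟨hv.1, hv.2, u, huC, huv⟩))
  convert this using 1
  ext v
  constructor
  · intro hv
    by_cases hc : v ∈ C
    · exact Or.inl (Or.inl hc)
    · exact Or.inr ⟨hv, hc⟩
  · rintro ((h | h) | h)
    · exact hCS h
    · exact h.1
    · exact h.1

lemma Dec.main [Finite V] {G : SimpleGraph V} (hθ : ¬ HasTheta G) (hpy : ¬ HasPyramid G)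
    (hpr : ¬ HasPrism G) (hw : ¬ HasWheel G) (S : Set V) : Dec G (GoodBag G) S := by
  induction S using WellFoundedLT.induction with
  | _ S ih =>
  by_cases hhole : ∃ H ⊆ S, IsHoleSet G H
  · -- there is a hole
    obtain ⟨H, hHS, hH⟩ := hhole
    obtain ⟨p, n, hC, rfl⟩ := cyc_of_hole hH
    rw [hC.pts_eq] at hHS
    clear hH
    by_cases hall : S ⊆ Set.range p
    · rw [Set.Subset.antisymm hall hHS]
      exact Dec.fan hC
    · obtain ⟨c, hcS, hcH⟩ := Set.not_subset.1 hall
      have hcX : c ∈ S \ Set.range p := ⟨hcS, hcH⟩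
      have hsub := comp_sub (G := G) hcX
      have hN : ∀ x ∈ Set.range p, ∀ y ∈ Set.range p, (∃ u ∈ comp G (S \ Set.range p) c, G.Adj u x) →
          (∃ u ∈ comp G (S \ Set.range p) c, G.Adj u y) → x ≠ y → G.Adj x y := by
        rintro x hx y hy ⟨u, hu, hux⟩ ⟨v, hv, hvy⟩ hxy
        by_contra hn
        obtain ⟨k, q, h0, hk, hq, hch⟩ := comp_conn hu hv
        exact no_att hθ hpy hpr hw hC k ⟨q, x, y, fun i hi => (hsub (hq i hi)).2, hch, hx, hy, hxy, hn,
          by rwa [h0], by rwa [hk]⟩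
      have hn := hC.1
      have ha : ∃ a ∈ Set.range p, ∀ u ∈ comp G (S \ Set.range p) c, ¬ G.Adj u a := by
        by_contra hcon
        push Not at hcon
        have h02 := hN (p 0) ⟨0, rfl⟩ (p 2) ⟨2, rfl⟩ (hcon _ ⟨0, rfl⟩) (hcon _ ⟨2, rfl⟩)
          (hC.ne (by omega) (by omega))
        rw [hC.adj_iff (by omega) (by omega)] at h02
        omega
      obtain ⟨a, haH, haN⟩ := ha
      refine Dec.step ih (fun v hv => (hsub hv).1) ⟨c, comp_self⟩ (hHS haH)
        (fun h => (hsub h).2 haH) haN ?_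
      have hin : ∀ v, v ∈ S → v ∉ comp G (S \ Set.range p) c →
          (∃ u ∈ comp G (S \ Set.range p) c, G.Adj u v) → v ∈ Set.range p := by
        rintro v hvS hvC ⟨u, hu, huv⟩
        by_contra hvH
        exact hvC (comp_closed hcX hu ⟨hvS, hvH⟩ huv)
      rintro x ⟨hx1, hx2, hx3⟩ y ⟨hy1, hy2, hy3⟩ hxy
      exact hN x (hin x hx1 hx2 hx3) y (hin y hy1 hy2 hy3) hx3 hy3 hxy
  · by_cases hcl : G.IsClique S
    · exact Dec.base (Or.inl hcl)
    · have : ∃ a ∈ S, ∃ b ∈ S, a ≠ b ∧ ¬ G.Adj a b := by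
        by_contra hcon
        push Not at hcon
        exact hcl (fun a ha b hb hab => hcon a ha b hb hab)
      obtain ⟨a, haS, b, hbS, hab, hnab⟩ := this
      set X : Set V := {v | v ∈ S ∧ v ≠ a ∧ ¬ G.Adj a v} with hX
      have hbX : b ∈ X := ⟨hbS, hab.symm, hnab⟩
      have hsub := comp_sub (G := G) hbX
      refine Dec.step ih (C := comp G X b) (fun v hv => (hsub hv).1) ⟨b, comp_self⟩ haS
        (fun h => (hsub h).2.1 rfl) (fun u hu h => (hsub hu).2.2 h.symm) ?_
      have hin : ∀ v, v ∈ S → v ∉ comp G X b → (∃ u ∈ comp G X b, G.Adj u v) → G.Adj a v := by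
        rintro v hvS hvC ⟨u, hu, huv⟩
        by_contra hav
        refine hvC (comp_closed hbX hu ⟨hvS, ?_, hav⟩ huv)
        rintro rfl
        exact (hsub hu).2.2 huv.symm
      rintro x ⟨hx1, hx2, hx3⟩ y ⟨hy1, hy2, hy3⟩ hxy
      have hax := hin x hx1 hx2 hx3
      have hay := hin y hy1 hy2 hy3
      by_contra hnxy
      apply hhole
      obtain ⟨u, hu, hux⟩ := hx3
      obtain ⟨v, hv, hvy⟩ := hy3
      obtain ⟨k, q, h0, hk, hq, hch⟩ := comp_conn hu hv
      obtain ⟨t, -, r, hind, hrX, hr0, hrt⟩ := exists_ind (G := G)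
        (X := {w | w ∈ comp G X b ∨ w = x ∨ w = y}) (k + 2)
        (fun i => if i = 0 then x else if i ≤ k + 1 then q (i - 1) else y)
        (by
          intro i hi
          beta_reduce
          split_ifs
          · exact Or.inr (Or.inl rfl)
          · exact Or.inl (hq _ (by omega))
          · exact Or.inr (Or.inr rfl))
        (by
          intro i hi
          beta_reduce
          by_cases hi0 : i = 0
          · subst hi0
            simp only [if_true]
            rw [if_neg (by omega), if_pos (by omega)]
            simp only [Nat.zero_add, Nat.sub_self]
            rw [h0]; exact hux.symm
          · rw [if_neg hi0, if_pos (by omega), if_neg (by omega)]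
            split_ifs with h
            · have := hch (i - 1) (by omega)
              rwa [show i - 1 + 1 = i + 1 - 1 by omega] at this
            · rw [show i - 1 = k by omega, hk]; exact hvy)
      simp only [if_true] at hr0
      rw [if_neg (by omega), if_neg (by omega)] at hrt
      have ht1 : t ≠ 0 := by
        rintro rfl
        exact hxy (hr0.symm.trans hrt)
      have hra : ∀ l ≤ t, (G.Adj a (r l) ↔ l = 0 ∨ l = t) := by
        intro l hl
        constructor
        · intro hadj
          by_contra hcon
          push Not at hcon
          rcases hrX l hl with h | h | h
          · exact (hsub h).2.2 hadj
          · exact (hind 0 l (by omega) hl (by omega)).1 (hr0.trans h.symm)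
          · exact (hind l t hl le_rfl (by omega)).1 (h.trans hrt.symm)
        · rintro (rfl | rfl)
          · rw [hr0]; exact hax
          · rw [hrt]; exact hay
      have ht2 : t ≠ 1 := by
        rintro rfl
        have := (hind 0 1 (by omega) (by omega) (by omega)).2.2 rfl
        rw [hr0, hrt] at this
        exact hnxy this
      have hrS : ∀ l ≤ t, r l ∈ S ∧ r l ≠ a := by
        intro l hl
        rcases hrX l hl with h | h | h
        · exact ⟨(hsub h).1, (hsub h).2.1⟩
        · rw [h]; exact ⟨hx1, hax.ne'⟩
        · rw [h]; exact ⟨hy1, hay.ne'⟩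
      refine ⟨_, ?_, hole_of_two (G := G) (p := r) (q := fun _ => a) (t := t) (k := 0) hind
        (fun i j hi hj hij => by omega) (by omega) (by omega) (fun i hi l hl => (hrS l hl).2.symm) ?_⟩
      · rintro w (⟨i, -, hi, rfl⟩ | ⟨i, -, hi, rfl⟩)
        · exact (hrS i hi).1
        · exact haS
      · intro i hi l hl
        rw [hra l hl]
        omega

lemma no_tri {G : SimpleGraph V} (h : Free G (⊤ : SimpleGraph (Fin 3))) {a b c : V} (hab : G.Adj a b)
    (hac : G.Adj a c) (hbc : G.Adj b c) : False := by
  apply h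
  let f : Fin 3 → V := ![a, b, c]
  have hadj : ∀ i j : Fin 3, i ≠ j → G.Adj (f i) (f j) := by
    intro i j hij
    fin_cases i <;> fin_cases j <;>
      first
      | exact absurd rfl hij
      | exact hab
      | exact hac
      | exact hbc
      | exact hab.symm
      | exact hac.symm
      | exact hbc.symm
  have hinj : Function.Injective f := by
    intro i j hij
    by_contra hne
    exact (hadj i j hne).ne hij
  refine ⟨Set.range f, ⟨RelIso.symm ⟨Equiv.ofInjective f hinj, ?_⟩⟩⟩
  intro i j
  constructor
  · intro h'
    rw [top_adj]
    rintro rfl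
    exact G.loopless.irrefl _ h'
  · intro h'
    exact hadj i j ((top_adj _ _).1 h')

lemma cliqueNum_le [Finite V] {G : SimpleGraph V} (h : Free G (⊤ : SimpleGraph (Fin 3))) :
    cliqueNum G ≤ 2 := by
  refine csSup_le ⟨0, ∅, by simp, by simp⟩ ?_
  rintro n ⟨S, hS, rfl⟩
  by_contra hcon
  push Not at hcon
  obtain ⟨a, ha, b, hb, c, hc, hab, hac, hbc⟩ := (Set.two_lt_ncard (Set.toFinite S)).1 hcon
  exact no_tri h (hS ha hb hab) (hS ha hc hac) (hS hb hc hbc)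


theorem statement9 :
    (∀ (V : Type) [Fintype V] (G : SimpleGraph V),
      ¬ HasTheta G → ¬ HasPyramid G → ¬ HasPrism G → ¬ HasWheel G →
      treewidth G ≤ max (cliqueNum G - 1) 2 ∧ treeCliqueCoverNum G ≤ 2) ∧
    (∀ (V : Type) [Fintype V] (G : SimpleGraph V),
      ¬ HasTheta G → ¬ HasWheel G → Free G (⊤ : SimpleGraph (Fin 3)) →
      treewidth G ≤ 2) := by
  refine ⟨fun V _ G h1 h2 h3 h4 => Dec.final (Dec.main h1 h2 h3 h4 _), fun V _ G h1 h4 h => ?_⟩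
  have h2 : ¬ HasPyramid G := by
    rintro ⟨a, b₁, b₂, b₃, P₁, P₂, P₃, h12, h13, h23, -⟩
    exact no_tri h h12 h13 h23
  have h3 : ¬ HasPrism G := by
    rintro ⟨a₁, a₂, a₃, b₁, b₂, b₃, P₁, P₂, P₃, h12, h13, h23, -⟩
    exact no_tri h h12 h13 h23
  have h5 := (Dec.final (Dec.main h1 h2 h3 h4 Set.univ)).1
  have h6 := cliqueNum_le h
  omega

end Paper
end

section
/- For every c ∈ [1/2, 1) and every positive integer k there exists an integer N such that the following holds: if G is a finite simple C4-free graph such that for every weight function w on G there exists a (w,c)-balanced separator X ⊆ V(G) with χ̄(G[X]) ≤ k, then tc(G) ≤ N. Here χ̄ is the clique cover number and tc the tree clique cover number. -/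
open SimpleGraph

namespace Paper

variable {V : Type*}

theorem walk_sum_inl {α β : Type*} {A : SimpleGraph α} {B : SimpleGraph β} {x y : α ⊕ β}
    (p : (A ⊕g B).Walk x y) : ∀ (v w : α) (hx : x = .inl v) (hy : y = .inl w),
      ∃ q : A.Walk v w, p.copy hx hy = (q.map (Embedding.sumInl (H := B)).toHom) := by
  induction p with
  | nil => 
    rintro v w rfl h
    cases h
    exact ⟨.nil, rfl⟩
  | cons h p ih =>
    rename_i u x' y'
    rintro v w rfl rfl
    rcases x' with x' | x'
    · obtain ⟨q, hq⟩ := ih x' w rfl rfl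
      refine ⟨.cons (by simpa using h) q, ?_⟩
      simp only [Walk.copy_rfl_rfl] at hq
      subst hq
      rfl
    · simp at h

theorem sum_no_cycle_inl {α β : Type*} {A : SimpleGraph α} {B : SimpleGraph β}
    (hA : A.IsAcyclic) (v : α) (p : (A ⊕g B).Walk (.inl v) (.inl v)) : ¬ p.IsCycle := by
  intro hp
  obtain ⟨q, hq⟩ := walk_sum_inl p v v rfl rfl
  simp only [Walk.copy_rfl_rfl] at hq
  rw [hq] at hp
  exact hA q ((Walk.isCycle_map_iff_of_injective (f := (Embedding.sumInl (G := A) (H := B)).toHom)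
    (Embedding.sumInl (G := A) (H := B)).injective).mp hp)

theorem sum_acyclic_s10 {α β : Type*} {A : SimpleGraph α} {B : SimpleGraph β}
    (hA : A.IsAcyclic) (hB : B.IsAcyclic) : (A ⊕g B).IsAcyclic := by
  rintro (v | v) p hp
  · exact sum_no_cycle_inl hA v p hp
  · refine sum_no_cycle_inl hB v (p.map (Iso.sumComm (G := A) (H := B)).toHom) ?_
    exact (Walk.isCycle_map_iff_of_injective (f := (Iso.sumComm (G := A) (H := B)).toHom)
      (Iso.sumComm (G := A) (H := B)).injective).mpr hp

/-- Every independent set contained in `S` has at most `a` elements. -/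
def Ab {V : Type*} (G : SimpleGraph V) (S : Set V) (a : ℕ) : Prop :=
  ∀ I : Finset V, (I : Set V) ⊆ S → (∀ u ∈ I, ∀ v ∈ I, ¬ G.Adj u v) → I.card ≤ a

/-- `G[U]` has a tree decomposition with bags of independence number at most `b`,
one of which contains `Z`. -/
def TDOn {V : Type*} (G : SimpleGraph V) (b : ℕ) (U Z : Set V) : Prop :=
  ∃ (ι : Type) (T : SimpleGraph ι) (bag : ι → Set V) (r : ι),
    T.IsAcyclic ∧ T.Connected ∧ Z ⊆ bag r ∧ (∀ t, bag t ⊆ U) ∧ (∀ t, Ab G (bag t) b) ∧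
    (∀ v ∈ U, (T.induce {t | v ∈ bag t}).Connected) ∧
    (∀ u ∈ U, ∀ v ∈ U, G.Adj u v → ∃ t, u ∈ bag t ∧ v ∈ bag t)

theorem TDOn.single {V : Type*} (G : SimpleGraph V) (b : ℕ) (U : Set V) (h : Ab G U b) :
    TDOn G b U U := by
  refine ⟨Unit, ⊥, fun _ => U, (), ?_, ?_, subset_rfl, fun _ => subset_rfl, fun _ => h, ?_,
    fun u hu v hv _ => ⟨(), hu, hv⟩⟩
  · exact isAcyclic_bot
  · exact ⟨fun a b => by cases a; cases b; rfl⟩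
  · intro v hv
    have : Nonempty ↑{t : Unit | v ∈ U} := ⟨⟨(), hv⟩⟩
    exact ⟨fun a b => by rw [Subsingleton.elim a b]⟩

theorem connected_induce_map {α β : Type*} {A : SimpleGraph α} {B : SimpleGraph β} (f : A →g B)
    (s : Set α) (h : (A.induce s).Connected) : (B.induce (f '' s)).Connected := by
  refine Connected.map (G := A.induce s) ⟨fun x => ⟨f x.1, x.1, x.2, rfl⟩, ?_⟩ ?_ h
  · intro a b hab
    exact f.map_adj hab
  · rintro ⟨_, x, hx, rfl⟩
    exact ⟨⟨x, hx⟩, rfl⟩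

theorem TDOn.glue {V : Type*} {G : SimpleGraph V} {b : ℕ} {U₁ U₂ Z₁ Z₂ : Set V}
    (h₁ : TDOn G b U₁ Z₁) (h₂ : TDOn G b U₂ Z₂) (hi₁ : U₁ ∩ U₂ ⊆ Z₁) (hi₂ : U₁ ∩ U₂ ⊆ Z₂)
    (hno : ∀ u ∈ U₁, ∀ v ∈ U₂, u ∉ U₂ → v ∉ U₁ → ¬ G.Adj u v) : TDOn G b (U₁ ∪ U₂) Z₁ := by
  obtain ⟨ι₁, T₁, b₁, r₁, ac₁, co₁, hZ₁, hU₁, hb₁, hs₁, he₁⟩ := h₁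
  obtain ⟨ι₂, T₂, b₂, r₂, ac₂, co₂, hZ₂, hU₂, hb₂, hs₂, he₂⟩ := h₂
  let T := (T₁ ⊕g T₂) ⊔ edge (Sum.inl r₁) (Sum.inr r₂)
  let f₁ : T₁ →g T := (Hom.ofLE le_sup_left).comp (Embedding.sumInl (H := T₂)).toHom
  let f₂ : T₂ →g T := (Hom.ofLE le_sup_left).comp (Embedding.sumInr (G := T₁)).toHom
  have hf₁ : ∀ x, f₁ x = Sum.inl x := fun _ => rfl
  have hf₂ : ∀ x, f₂ x = Sum.inr x := fun _ => rfl
  have hadj : T.Adj (f₁ r₁) (f₂ r₂) := by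
    rw [hf₁, hf₂]
    simp [T, edge]
  refine ⟨ι₁ ⊕ ι₂, T, Sum.elim b₁ b₂, Sum.inl r₁, ?_, ?_, hZ₁, ?_, ?_, ?_, ?_⟩
  · exact (sum_acyclic_s10 ac₁ ac₂).sup_edge_of_not_reachable (not_reachable_sum_inl_inr _ _)
  · exact co₁.sum_sup_edge co₂
  · rintro (t | t)
    · exact (hU₁ t).trans Set.subset_union_left
    · exact (hU₂ t).trans Set.subset_union_right
  · rintro (t | t)
    · exact hb₁ t
    · exact hb₂ t
  · intro v hv
    have hset : {t | v ∈ Sum.elim b₁ b₂ t} = f₁ '' {t | v ∈ b₁ t} ∪ f₂ '' {t | v ∈ b₂ t} := by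
      ext (t | t) <;> simp [hf₁, hf₂]
    rw [hset]
    by_cases hv1 : v ∈ U₁
    · have c1 := connected_induce_map f₁ _ (hs₁ v hv1)
      by_cases hv2 : v ∈ U₂
      · have c2 := connected_induce_map f₂ _ (hs₂ v hv2)
        exact connected_induce_union c1.preconnected c2.preconnected
          ⟨r₁, hZ₁ (hi₁ ⟨hv1, hv2⟩), rfl⟩ ⟨r₂, hZ₂ (hi₂ ⟨hv1, hv2⟩), rfl⟩ hadj
      · have : {t | v ∈ b₂ t} = ∅ := by
          ext t; simpa using fun h => hv2 (hU₂ t h)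
        rw [this, Set.image_empty, Set.union_empty]
        exact c1
    · have hv2 : v ∈ U₂ := hv.resolve_left hv1
      have c2 := connected_induce_map f₂ _ (hs₂ v hv2)
      have : {t | v ∈ b₁ t} = ∅ := by
        ext t; simpa using fun h => hv1 (hU₁ t h)
      rw [this, Set.image_empty, Set.empty_union]
      exact c2
  · have key1 : ∀ u ∈ U₁, ∀ v ∈ U₁, G.Adj u v →
        ∃ t, u ∈ Sum.elim b₁ b₂ t ∧ v ∈ Sum.elim b₁ b₂ t := fun u hu v hv h => by
      obtain ⟨t, ht⟩ := he₁ u hu v hv h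
      exact ⟨.inl t, ht⟩
    have key2 : ∀ u ∈ U₂, ∀ v ∈ U₂, G.Adj u v →
        ∃ t, u ∈ Sum.elim b₁ b₂ t ∧ v ∈ Sum.elim b₁ b₂ t := fun u hu v hv h => by
      obtain ⟨t, ht⟩ := he₂ u hu v hv h
      exact ⟨.inr t, ht⟩
    intro u hu v hv h
    by_cases hu1 : u ∈ U₁ <;> by_cases hv1 : v ∈ U₁
    · exact key1 u hu1 v hv1 h
    · have hv2 := hv.resolve_left hv1
      by_cases hu2 : u ∈ U₂
      · exact key2 u hu2 v hv2 h
      · exact absurd h (hno u hu1 v hv2 hu2 hv1)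
    · have hu2 := hu.resolve_left hu1
      by_cases hv2 : v ∈ U₂
      · exact key2 u hu2 v hv2 h
      · exact absurd h.symm (hno v hv1 u hu2 hv2 hu1)
    · exact key2 u (hu.resolve_left hu1) v (hv.resolve_left hv1) h

theorem c4_of_free {V : Type*} {G : SimpleGraph V} (h : ¬ ∃ S : Set V, Nonempty (G.induce S ≃g cycleGraph 4))
    {i j u v : V} (hij : i ≠ j) (nij : ¬ G.Adj i j) (huv : u ≠ v) (iu : G.Adj i u) (iv : G.Adj i v)
    (ju : G.Adj j u) (jv : G.Adj j v) : G.Adj u v := by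
  by_contra nuv
  apply h
  have := iu.ne
  have := iv.ne
  have := ju.ne
  have := jv.ne
  let g : Fin 4 → V := ![i, u, j, v]
  have hcyc : ∀ a b : Fin 4, (cycleGraph 4).Adj a b ↔ a.val % 2 ≠ b.val % 2 := by decide
  have hg : ∀ a b : Fin 4, G.Adj (g a) (g b) ↔ a.val % 2 ≠ b.val % 2 := by
    have nji : ¬ G.Adj j i := fun h => nij h.symm
    have nvu : ¬ G.Adj v u := fun h => nuv h.symm
    intro a b
    fin_cases a <;> fin_cases b <;>
      simp [g, iu, iv, ju, jv, iu.symm, iv.symm, ju.symm, jv.symm, nij, nuv, nji, nvu]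
  have hinj : Function.Injective g := by
    intro a b
    fin_cases a <;> fin_cases b <;> simp [g] <;> grind
  let f : cycleGraph 4 ↪g G := ⟨⟨g, hinj⟩, fun {a b} => (hg a b).trans (hcyc a b).symm⟩
  exact ⟨Set.range f, ⟨f.isoInduceRange.symm⟩⟩

theorem exists_max_indep {V : Type*} [Finite V] (G : SimpleGraph V) (S : Set V) :
    ∃ I : Finset V, (I : Set V) ⊆ S ∧ (∀ u ∈ I, ∀ v ∈ I, ¬ G.Adj u v) ∧ Ab G S I.card := by
  classical
  have := Fintype.ofFinite V
  let P : Finset (Finset V) :=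
    Finset.univ.filter fun I => (I : Set V) ⊆ S ∧ ∀ u ∈ I, ∀ v ∈ I, ¬ G.Adj u v
  obtain ⟨I, hI, hmax⟩ := P.exists_max_image Finset.card ⟨∅, by simp [P]⟩
  simp only [P, Finset.mem_filter, Finset.mem_univ, true_and] at hI hmax
  exact ⟨I, hI.1, hI.2, fun J h1 h2 => hmax J ⟨h1, h2⟩⟩

theorem cliqueCoverNum_le_of_map {V W : Type*} [Finite V] (G : SimpleGraph V) (R : Finset W)
    (f : V → W) (hf : ∀ v, f v ∈ R) (hc : ∀ u v, f u = f v → u ≠ v → G.Adj u v) :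
    cliqueCoverNum G ≤ R.card := by
  classical
  have : (R.image fun w => f ⁻¹' {w}).card ≤ R.card := Finset.card_image_le
  refine le_trans (Nat.sInf_le ⟨R.image fun w => f ⁻¹' {w}, rfl, ?_, ?_⟩) this
  · intro C hC
    obtain ⟨w, -, rfl⟩ := Finset.mem_image.mp hC
    intro u hu v hv huv
    exact hc u v (by rw [hu, hv]) huv
  · intro v
    refine ⟨f ⁻¹' {f v}, ⟨Finset.mem_image.mpr ⟨f v, hf v, rfl⟩, rfl⟩, ?_⟩
    rintro C ⟨hC, hv⟩
    obtain ⟨w, -, rfl⟩ := Finset.mem_image.mp hC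
    have : f v = w := hv
    rw [this]

theorem wagon {V : Type*} [Finite V] (G : SimpleGraph V) (a : ℕ) (ha : Ab G Set.univ a)
    (h4 : ∀ i j u v : V, i ≠ j → ¬ G.Adj i j → u ≠ v → G.Adj i u → G.Adj i v → G.Adj j u →
      G.Adj j v → G.Adj u v) : cliqueCoverNum G ≤ a * a := by
  classical
  obtain ⟨I, -, hI, hmax⟩ := exists_max_indep G Set.univ
  have hIa : I.card ≤ a := ha I (Set.subset_univ _) hI
  have key : ∀ v : V, ∃ p : V × V, p ∈ I ×ˢ I ∧
      ((p.1 ≠ p.2 ∧ G.Adj p.1 v ∧ G.Adj p.2 v) ∨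
       (p.1 = p.2 ∧ ∀ j ∈ I, (j = v ∨ G.Adj j v) → j = p.1)) := by
    intro v
    by_cases h : ∃ i ∈ I, ∃ j ∈ I, i ≠ j ∧ G.Adj i v ∧ G.Adj j v
    · obtain ⟨i, hi, j, hj, h⟩ := h
      exact ⟨(i, j), Finset.mem_product.mpr ⟨hi, hj⟩, .inl h⟩
    · push Not at h
      have hex : ∃ i ∈ I, i = v ∨ G.Adj i v := by
        by_contra hcon
        push Not at hcon
        have hv : v ∉ I := fun hv => (hcon v hv).1 rfl
        have := hmax (insert v I) (Set.subset_univ _) (by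
          intro x hx y hy hxy
          rw [Finset.mem_insert] at hx hy
          rcases hx with rfl | hx <;> rcases hy with rfl | hy
          · exact hxy.ne rfl
          · exact (hcon y hy).2 hxy.symm
          · exact (hcon x hx).2 hxy
          · exact hI x hx y hy hxy)
        rw [Finset.card_insert_of_notMem hv] at this
        omega
      obtain ⟨i, hi, hiv⟩ := hex
      refine ⟨(i, i), Finset.mem_product.mpr ⟨hi, hi⟩, .inr ⟨rfl, ?_⟩⟩
      intro j hj hjv
      by_contra hne
      rcases hjv with rfl | hjv
      · rcases hiv with rfl | hiv
        · exact hne rfl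
        · exact hI _ hi _ hj hiv
      · rcases hiv with rfl | hiv
        · exact hI _ hj _ hi hjv
        · exact h i hi j hj (Ne.symm hne) hiv hjv
  choose f hf hf' using key
  refine (cliqueCoverNum_le_of_map G (I ×ˢ I) f hf ?_).trans ?_
  · intro u v huv hne
    have hu := hf' u
    have hv := hf' v
    rw [← huv] at hv
    have hm := Finset.mem_product.mp (hf u)
    rcases hu with ⟨h1, h2, h3⟩ | ⟨h1, h2⟩
    · rcases hv with ⟨-, h5, h6⟩ | ⟨h4', -⟩
      · exact h4 _ _ u v h1 (hI _ hm.1 _ hm.2) hne h2 h5 h3 h6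
      · exact absurd h4' h1
    · rcases hv with ⟨h3, -⟩ | ⟨-, h5⟩
      · exact absurd h1 h3
      · by_contra hnadj
        set i := (f u).1
        have hu' : u ∉ I.erase i := fun h =>
          (Finset.mem_erase.mp h).1 (h2 u (Finset.mem_erase.mp h).2 (.inl rfl))
        have hv' : v ∉ I.erase i := fun h =>
          (Finset.mem_erase.mp h).1 (h5 v (Finset.mem_erase.mp h).2 (.inl rfl))
        have hu'' : u ∉ insert v (I.erase i) := by
          rw [Finset.mem_insert]
          rintro (h | h)
          · exact hne h
          · exact hu' h
        have e2 : ∀ y ∈ I.erase i, ¬ G.Adj y u := fun y hy h =>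
          (Finset.mem_erase.mp hy).1 (h2 y (Finset.mem_erase.mp hy).2 (.inr h))
        have e5 : ∀ y ∈ I.erase i, ¬ G.Adj y v := fun y hy h =>
          (Finset.mem_erase.mp hy).1 (h5 y (Finset.mem_erase.mp hy).2 (.inr h))
        have := hmax (insert u (insert v (I.erase i))) (Set.subset_univ _) (by
          intro x hx y hy hxy
          simp only [Finset.mem_insert] at hx hy
          rcases hx with rfl | rfl | hx <;> rcases hy with rfl | rfl | hy
          · exact hxy.ne rfl
          · exact hnadj hxy
          · exact e2 y hy hxy.symm
          · exact hnadj hxy.symm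
          · exact hxy.ne rfl
          · exact e5 y hy hxy.symm
          · exact e2 x hx hxy
          · exact e5 x hx hxy
          · exact hI x (Finset.mem_of_mem_erase hx) y (Finset.mem_of_mem_erase hy) hxy)
        rw [Finset.card_insert_of_notMem hu'', Finset.card_insert_of_notMem hv',
          Finset.card_erase_of_mem hm.1] at this
        have := Finset.card_pos.mpr ⟨_, hm.1⟩
        omega
  · rw [Finset.card_product]
    exact Nat.mul_le_mul hIa hIa

theorem Ab.of_cover {V : Type*} [Finite V] (G : SimpleGraph V) (X : Set V) (k : ℕ)
    (h : cliqueCoverNum (G.induce X) ≤ k) : Ab G X k := by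
  classical
  have := Fintype.ofFinite V
  have hne : {n | ∃ F : Finset (Set X), F.card = n ∧ (∀ C ∈ F, (G.induce X).IsClique C) ∧
    ∀ v : X, ∃! C : Set X, C ∈ F ∧ v ∈ C}.Nonempty := by
    refine ⟨_, Finset.univ.image (fun v : X => ({v} : Set X)), rfl, ?_, ?_⟩
    · intro C hC
      obtain ⟨w, -, rfl⟩ := Finset.mem_image.mp hC
      exact Set.pairwise_singleton _ _
    · intro v
      refine ⟨{v}, ⟨Finset.mem_image.mpr ⟨v, Finset.mem_univ _, rfl⟩, rfl⟩, ?_⟩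
      rintro C ⟨hC, hv⟩
      obtain ⟨w, -, rfl⟩ := Finset.mem_image.mp hC
      have : v = w := hv
      rw [this]
  obtain ⟨F, hF, hcl, hcov⟩ := Nat.sInf_mem hne
  intro I hIX hI
  refine le_trans ?_ h
  unfold cliqueCoverNum
  rw [← hF]
  choose g hg _ using hcov
  refine Finset.card_le_card_of_injOn
    (fun v => if hv : v ∈ X then g ⟨v, hv⟩ else ∅) ?_ ?_
  · intro v hv
    have hvX := hIX hv
    simp only [hvX, dif_pos]
    exact (hg ⟨v, hvX⟩).1
  · intro u hu v hv huv
    have huX := hIX hu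
    have hvX := hIX hv
    simp only [huX, hvX, dif_pos] at huv
    by_contra hne
    have h1 := hg ⟨u, huX⟩
    have h2 := hg ⟨v, hvX⟩
    rw [← huv] at h2
    exact hI u hu v hv (hcl _ h1.1 h1.2 h2.2 (by simpa using hne))

theorem Ab.induce {V : Type*} {G : SimpleGraph V} {S : Set V} {a : ℕ} (h : Ab G S a) :
    Ab (G.induce S) Set.univ a := by
  intro I _ hI
  have := h (I.map (Function.Embedding.subtype _)) (by
    intro x hx
    simp at hx
    exact hx.1) (by
    intro u hu v hv
    simp only [Finset.mem_map] at hu hv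
    obtain ⟨u, hu, rfl⟩ := hu
    obtain ⟨v, hv, rfl⟩ := hv
    exact hI u hu v hv)
  simpa using this

theorem Ab.mono {V : Type*} {G : SimpleGraph V} {S T : Set V} {a b : ℕ} (h : Ab G S a)
    (hT : T ⊆ S) (hab : a ≤ b) : Ab G T b :=
  fun I h1 h2 => (h I (h1.trans hT) h2).trans hab

theorem Ab.union {V : Type*} {G : SimpleGraph V} {S T : Set V} {a b : ℕ} (h : Ab G S a)
    (h' : Ab G T b) : Ab G (S ∪ T) (a + b) := by
  classical
  intro I h1 h2
  have e := Finset.card_filter_add_card_filter_not (s := I) (fun x => x ∈ S)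
  have p1 := h (I.filter fun x => x ∈ S) (by intro x; simp) (by
    intro u hu v hv
    exact h2 u (Finset.mem_of_mem_filter _ hu) v (Finset.mem_of_mem_filter _ hv))
  have p2 := h' (I.filter fun x => ¬ x ∈ S) (by
    intro x hx
    simp only [Finset.coe_filter, Set.mem_ofPred_eq] at hx
    exact (h1 hx.1).resolve_left hx.2) (by
    intro u hu v hv
    exact h2 u (Finset.mem_of_mem_filter _ hu) v (Finset.mem_of_mem_filter _ hv))
  omega

theorem wSet_indicator {V : Type*} [Fintype V] [DecidableEq V] (I : Finset V) (S : Set V)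
    [DecidablePred (· ∈ S)] (a : ℝ) :
    wSet (fun x => if x ∈ I then a else 0) S = (I.filter (· ∈ S)).card * a := by
  unfold wSet
  have : (∑ᶠ x ∈ S, if x ∈ I then a else 0) =
      ∑ x ∈ Finset.univ.filter (· ∈ S), if x ∈ I then a else 0 := by
    rw [← finsum_mem_coe_finset]
    simp
  rw [this, ← Finset.sum_filter, Finset.sum_const, nsmul_eq_mul]
  congr 3
  ext x
  simp [and_comm]

theorem sep_step {V : Type*} [Fintype V] (G : SimpleGraph V) (c : ℝ) (k : ℕ)
    (hsep : ∀ w : V → ℝ, IsWeightFn w →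
        ∃ X : Set V, IsBalancedSep G w c X ∧ cliqueCoverNum (G.induce X) ≤ k)
    (Z : Set V) (hZ : Z.Nonempty) (hc0 : 0 ≤ c) (M : ℕ) (hM : Ab G Z (M + 1))
    (hMk : c * (M + 1) + 2 * k ≤ M) :
    ∃ X : Set V, Ab G X k ∧ ∀ D : (G.induce Xᶜ).ConnectedComponent,
      Ab G ((Z ∩ Subtype.val '' D.supp) ∪ X) M := by
  classical
  obtain ⟨I, hIZ, hI, hmax⟩ := exists_max_indep G Z
  have hcard : 0 < I.card := by
    obtain ⟨z, hz⟩ := hZ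
    have := hmax {z} (by simpa using hz) (by simp)
    simp at this
    simpa [Finset.card_pos] using this
  have hcR : (0 : ℝ) < I.card := by exact_mod_cast hcard
  have hI1 : (I.card : ℝ) ≤ M + 1 := by exact_mod_cast hM I hIZ hI
  obtain ⟨X, hX, hXk⟩ := hsep (fun x => if x ∈ I then (1 / (I.card : ℝ)) else 0) (by
    constructor
    · intro v
      have h1 : 1 / (I.card : ℝ) ≤ 1 := by
        rw [div_le_one hcR]
        exact_mod_cast hcard
      have h0 : 0 ≤ 1 / (I.card : ℝ) := by positivity
      dsimp only
      split_ifs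
      · exact ⟨h0, h1⟩
      · simp
    · rw [← Finset.sum_filter, Finset.sum_const, nsmul_eq_mul]
      simp
      field_simp)
  have hXa := Ab.of_cover G X k hXk
  refine ⟨X, hXa, fun D => ?_⟩
  set S : Set V := Subtype.val '' D.supp with hS
  have hw := hX D
  rw [← hS, wSet_indicator] at hw
  have hw' : ((I.filter (· ∈ S)).card : ℝ) ≤ c * I.card := by
    rw [mul_one_div, div_le_iff₀ hcR] at hw
    exact hw
  have hclosed : ∀ u v, v ∈ S → G.Adj u v → u ∉ X → u ∈ S := by
    rintro u _ ⟨v, hv, rfl⟩ huv hu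
    refine ⟨⟨u, hu⟩, ?_, rfl⟩
    exact D.mem_supp_of_adj_mem_supp hv (by simpa using huv.symm)
  have hab : Ab G (Z ∩ S) ((I.filter (· ∈ S)).card + k) := by
    intro J hJ hJi
    have hXI := hXa (I.filter (· ∈ X)) (by intro x; simp) (by
      intro u hu v hv
      exact hI u (Finset.mem_of_mem_filter _ hu) v (Finset.mem_of_mem_filter _ hv))
    let R := I.filter (fun x => ¬ (x ∈ S ∨ x ∈ X))
    have hR : I.card ≤ (I.filter (· ∈ S)).card + (I.filter (· ∈ X)).card + R.card := by
      have e := Finset.card_filter_add_card_filter_not (s := I) (fun x => x ∈ S ∨ x ∈ X)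
      have e2 : (I.filter (fun x => x ∈ S ∨ x ∈ X)).card ≤
          (I.filter (· ∈ S)).card + (I.filter (· ∈ X)).card := by
        rw [Finset.filter_or]
        exact Finset.card_union_le _ _
      have e3 : R.card = (I.filter (fun x => ¬ (x ∈ S ∨ x ∈ X))).card := rfl
      omega
    have hdisj : Disjoint J R := by
      rw [Finset.disjoint_left]
      intro x hx hxR
      exact (Finset.mem_filter.mp hxR).2 (.inl (hJ hx).2)
    have := hmax (J ∪ R) (by
      intro x hx
      rw [Finset.mem_coe, Finset.mem_union] at hx
      rcases hx with hx | hx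
      · exact (hJ hx).1
      · exact hIZ (Finset.mem_filter.mp hx).1) (by
      have hJR : ∀ x ∈ J, ∀ y ∈ R, ¬ G.Adj y x := by
        intro x hx y hy hyx
        have hy' := (Finset.mem_filter.mp hy).2
        push Not at hy'
        exact hy'.1 (hclosed y x (hJ hx).2 hyx hy'.2)
      intro x hx y hy hxy
      rw [Finset.mem_union] at hx hy
      rcases hx with hx | hx <;> rcases hy with hy | hy
      · exact hJi x hx y hy hxy
      · exact hJR x hx y hy hxy.symm
      · exact hJR y hy x hx hxy
      · exact hI x (Finset.mem_filter.mp hx).1 y (Finset.mem_filter.mp hy).1 hxy)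
    rw [Finset.card_union_of_disjoint hdisj] at this
    omega
  refine (hab.union hXa).mono subset_rfl ?_
  have : ((I.filter (· ∈ S)).card : ℝ) + k + k ≤ M := by
    have := mul_le_mul_of_nonneg_left hI1 hc0
    linarith
  exact_mod_cast this

theorem main_td {V : Type*} [Fintype V] (G : SimpleGraph V) (c : ℝ) (k : ℕ)
    (hsep : ∀ w : V → ℝ, IsWeightFn w →
        ∃ X : Set V, IsBalancedSep G w c X ∧ cliqueCoverNum (G.induce X) ≤ k)
    (hc0 : 0 ≤ c) (M : ℕ) (hMk : c * (M + 1) + 2 * k ≤ M) (n : ℕ) :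
    ∀ U Z : Set V, Z ⊆ U → Ab G Z M → (U \ Z).ncard ≤ n → TDOn G (M + 1 + k) U Z := by
  classical
  induction n with
  | zero =>
    intro U Z hZU hZ hn
    have h0 : U \ Z = ∅ := (Set.ncard_eq_zero (Set.toFinite _)).mp (by omega)
    have : U = Z := Set.Subset.antisymm (Set.sdiff_eq_empty.mp h0) hZU
    subst this
    exact TDOn.single G _ _ (hZ.mono subset_rfl (by omega))
  | succ n ih =>
    intro U Z hZU hZ hn
    by_cases hUZ : U ⊆ Z
    · have : U = Z := Set.Subset.antisymm hUZ hZU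
      subst this
      exact TDOn.single G _ _ (hZ.mono subset_rfl (by omega))
    obtain ⟨v, hvU, hvZ⟩ := Set.not_subset.mp hUZ
    have hv1 : Ab G {v} 1 := by
      intro I hI _
      have : I ⊆ {v} := by
        intro x hx
        simpa using hI hx
      simpa using Finset.card_le_card this
    have hZ' : Ab G (Z ∪ {v}) (M + 1) := hZ.union hv1
    set Z' : Set V := Z ∪ {v} with hZdef
    have hZ'U : Z' ⊆ U := Set.union_subset hZU (by simpa using hvU)
    obtain ⟨X, hX, hD⟩ := sep_step G c k hsep Z' ⟨v, .inr rfl⟩ hc0 M hZ' hMk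
    let K : (G.induce Xᶜ).ConnectedComponent → Set V := fun D => Subtype.val '' D.supp
    have hKX : ∀ D, ∀ x ∈ K D, x ∉ X := by
      rintro D _ ⟨x, -, rfl⟩
      exact x.2
    have hKdisj : ∀ D D' x, x ∈ K D → x ∈ K D' → D = D' := by
      rintro D D' _ ⟨x, hx, rfl⟩ ⟨y, hy, hxy⟩
      have : y = x := Subtype.ext hxy
      subst this
      exact hx.symm.trans hy
    have hKadj : ∀ D u v, v ∈ K D → G.Adj u v → u ∉ X → u ∈ K D := by
      rintro D u _ ⟨v, hv, rfl⟩ huv hu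
      refine ⟨⟨u, hu⟩, ?_, rfl⟩
      exact D.mem_supp_of_adj_mem_supp hv (by simpa using huv.symm)
    have hchild : ∀ D, TDOn G (M + 1 + k) ((U ∩ K D) ∪ (X ∩ U)) ((Z' ∩ K D) ∪ (X ∩ U)) := by
      intro D
      apply ih
      · exact Set.union_subset_union_left _ (Set.inter_subset_inter_left _ hZ'U)
      · exact (hD D).mono (Set.union_subset_union_right _ Set.inter_subset_left) le_rfl
      · have hss : ((U ∩ K D) ∪ (X ∩ U)) \ ((Z' ∩ K D) ∪ (X ∩ U)) ⊂ U \ Z := by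
          constructor
          · rintro x ⟨hx | hx, hx2⟩
            · exact ⟨hx.1, fun hxZ => hx2 (.inl ⟨.inl hxZ, hx.2⟩)⟩
            · exact absurd (Or.inr hx) hx2
          · intro hcon
            obtain ⟨hx | hx, hx2⟩ := hcon ⟨hvU, hvZ⟩
            · exact hx2 (.inl ⟨.inr rfl, hx.2⟩)
            · exact hx2 (Or.inr hx)
        have := Set.ncard_lt_ncard hss (Set.toFinite _)
        omega
    set R : Set V := Z' ∪ (X ∩ U) with hR
    have hRU : R ⊆ U := Set.union_subset hZ'U Set.inter_subset_right
    have hRa : Ab G R (M + 1 + k) := hZ'.union (hX.mono Set.inter_subset_left le_rfl)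
    have := Fintype.ofFinite (G.induce Xᶜ).ConnectedComponent
    have hall : ∀ s : Finset (G.induce Xᶜ).ConnectedComponent,
        TDOn G (M + 1 + k) (R ∪ {x | ∃ D ∈ s, x ∈ U ∩ K D}) R := by
      intro s
      induction s using Finset.induction_on with
      | empty =>
        have : R ∪ {x | ∃ D ∈ (∅ : Finset (G.induce Xᶜ).ConnectedComponent), x ∈ U ∩ K D} = R := by
          ext x; simp
        rw [this]
        exact TDOn.single G _ _ hRa
      | insert D s hDs ihs =>
        have hset : R ∪ {x | ∃ D' ∈ insert D s, x ∈ U ∩ K D'} =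
            (R ∪ {x | ∃ D' ∈ s, x ∈ U ∩ K D'}) ∪ ((U ∩ K D) ∪ (X ∩ U)) := by
          ext x
          constructor
          · rintro (h | ⟨D', hD', h⟩)
            · exact .inl (.inl h)
            · rcases Finset.mem_insert.mp hD' with rfl | hD'
              · exact .inr (.inl h)
              · exact .inl (.inr ⟨D', hD', h⟩)
          · rintro ((h | ⟨D', hD', h⟩) | (h | h))
            · exact .inl h
            · exact .inr ⟨D', Finset.mem_insert_of_mem hD', h⟩
            · exact .inr ⟨D, Finset.mem_insert_self _ _, h⟩
            · exact .inl (.inr h)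
        have hint : ∀ x, x ∈ (R ∪ {x | ∃ D' ∈ s, x ∈ U ∩ K D'}) → x ∈ (U ∩ K D) ∪ (X ∩ U) →
            x ∈ R ∧ x ∈ (Z' ∩ K D) ∪ (X ∩ U) := by
          intro x h1 h2
          rcases h2 with h2 | h2
          · rcases h1 with h1 | ⟨D', hD', h1⟩
            · refine ⟨h1, ?_⟩
              rcases h1 with h1 | h1
              · exact .inl ⟨h1, h2.2⟩
              · exact .inr h1
            · exact absurd (hKdisj _ _ x h2.2 h1.2 ▸ hD') hDs
          · exact ⟨.inr h2, .inr h2⟩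
        rw [hset]
        refine ihs.glue (hchild D) (fun x hx => (hint x hx.1 hx.2).1)
          (fun x hx => (hint x hx.1 hx.2).2) ?_
        intro x hx y hy hx2 hy1 hxy
        have hyK : y ∈ K D := by
          rcases hy with hy | hy
          · exact hy.2
          · exact absurd (Or.inl (Or.inr hy)) hy1
        have hxU : x ∈ U := by
          rcases hx with hx | ⟨D', hD', hx⟩
          · exact hRU hx
          · exact hx.1
        have hxX : x ∉ X := fun h => hx2 (.inr ⟨h, hxU⟩)
        exact hx2 (.inl ⟨hxU, hKadj D x y hyK hxy hxX⟩)
    have hfin := hall Finset.univ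
    have hU : R ∪ {x | ∃ D ∈ (Finset.univ : Finset (G.induce Xᶜ).ConnectedComponent),
        x ∈ U ∩ K D} = U := by
      ext x
      constructor
      · rintro (h | ⟨D', hD', h⟩)
        · exact hRU h
        · exact h.1
      · intro hx
        by_cases hxX : x ∈ X
        · exact .inl (.inr ⟨hxX, hx⟩)
        · exact .inr ⟨(G.induce Xᶜ).connectedComponentMk ⟨x, hxX⟩, Finset.mem_univ _, hx,
            ⟨x, hxX⟩, rfl, rfl⟩
    rw [hU] at hfin
    obtain ⟨ι, T, bag, r, h1, h2, h3, h4⟩ := hfin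
    exact ⟨ι, T, bag, r, h1, h2, fun x hx => h3 (.inl (.inl hx)), h4⟩

theorem statement10 (c : ℝ) (hc₁ : 1 / 2 ≤ c) (hc₂ : c < 1) (k : ℕ) (hk : 0 < k) :
    ∃ N : ℤ, ∀ (V : Type) [Fintype V] (G : SimpleGraph V),
      Free G (cycleGraph 4) →
      (∀ w : V → ℝ, IsWeightFn w →
        ∃ X : Set V, IsBalancedSep G w c X ∧ cliqueCoverNum (G.induce X) ≤ k) →
      (treeCliqueCoverNum G : ℤ) ≤ N := by
  have h1c : 0 < 1 - c := by linarith
  obtain ⟨M, hM⟩ := exists_nat_ge ((c + 2 * k) / (1 - c))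
  rw [div_le_iff₀ h1c] at hM
  have hMk : c * (M + 1) + 2 * k ≤ M := by linarith
  refine ⟨(((M + 1 + k) * (M + 1 + k) : ℕ) : ℤ), ?_⟩
  intro V _ G hfree hsep
  have hnil : Ab G (∅ : Set V) M := by
    intro I hI _
    have : I = ∅ := by simpa using hI
    simp [this]
  obtain ⟨ι, T, bag, r, h1, h2, -, -, h5, h6, h7⟩ :=
    main_td G c k hsep (by linarith) M hMk (Set.univ \ (∅ : Set V)).ncard Set.univ ∅
      (Set.empty_subset _) hnil le_rfl
  have : treeCliqueCoverNum G ≤ (M + 1 + k) * (M + 1 + k) := by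
    refine Nat.sInf_le ⟨⟨ι, T, h1, h2, bag, ?_, ?_, fun v => h6 v trivial⟩, ?_⟩
    · intro v
      obtain ⟨t⟩ := (h6 v trivial).nonempty
      exact ⟨t.1, t.2⟩
    · intro u v huv
      exact h7 u trivial v trivial huv
    · intro t
      refine wagon (G.induce (bag t)) _ (h5 t).induce ?_
      intro i j u v hij nij huv iu iv ju jv
      exact c4_of_free hfree (fun h => hij (Subtype.ext h)) nij (fun h => huv (Subtype.ext h))
        iu iv ju jv
  exact_mod_cast this

end Paper
end
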